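/- Let p be an odd prime, q = 3^p, and G = PSL(2, q). If x, y ∈ G satisfy Sol_G(x) = Sol_G(y), then x and y are contained in exactly the same maximal subgroups of G; that is, for every maximal subgroup M of G, x ∈ M if and only if y ∈ M. -/

import Mathlib

/-- The solvabilizer of an element `x` of a group `G`:
the set of `y ∈ G` such that `⟨x, y⟩` is solvable. -/
def solvabilizer {G : Type*} [Group G] (x : G) : Set G :=
  {y | IsSolvable ↥(Subgroup.closure {x, y})}

/-- The projective special linear group `PSL(n, R)`. -/
noncomputable abbrev PSL (n : ℕ) (R : Type*) [CommRing R] : Type _ :=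
  Matrix.SpecialLinearGroup (Fin n) R ⧸
    Subgroup.center (Matrix.SpecialLinearGroup (Fin n) R)

/-- The group `SL(2, F)`. -/
abbrev SL2 (F : Type*) [Field F] := Matrix.SpecialLinearGroup (Fin 2) F

/-- The ring of `2 × 2` matrices. -/
abbrev M2 (F : Type*) [Field F] := Matrix (Fin 2) (Fin 2) F

section basics
variable {F : Type*} [Field F]

theorem m2_ext_iff (A B : M2 F) : A = B ↔
    A 0 0 = B 0 0 ∧ A 0 1 = B 0 1 ∧ A 1 0 = B 1 0 ∧ A 1 1 = B 1 1 := by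
  constructor
  · rintro rfl; simp
  · rintro ⟨h1, h2, h3, h4⟩
    ext i j; fin_cases i <;> fin_cases j <;> assumption

theorem m2_mul (A B : M2 F) (i j : Fin 2) : (A * B) i j = A i 0 * B 0 j + A i 1 * B 1 j := by
  simp [Matrix.mul_apply]

theorem m2_det (A : M2 F) : A.det = A 0 0 * A 1 1 - A 0 1 * A 1 0 := Matrix.det_fin_two A

theorem m2_tr (A : M2 F) : A.trace = A 0 0 + A 1 1 := Matrix.trace_fin_two A

theorem sl2_det (g : SL2 F) : g.1 0 0 * g.1 1 1 - g.1 0 1 * g.1 1 0 = 1 := by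
  have := g.2; rwa [m2_det] at this

/-- A matrix commuting with a nonscalar matrix is a polynomial in it. -/
theorem commutant (X Y : M2 F) (h : X * Y = Y * X) (hX : ∀ r : F, X ≠ r • 1) :
    ∃ α β : F, Y = α • 1 + β • X := by
  simp only [m2_ext_iff, m2_mul, ne_eq] at h hX
  have hX' := hX (X 0 0)
  simp at hX'
  simp only [m2_ext_iff]
  obtain ⟨h1, h2, h3, h4⟩ := h
  by_cases h01 : X 0 1 = 0
  · by_cases h10 : X 1 0 = 0
    · have h5 : X 0 0 - X 1 1 ≠ 0 := by
        intro h; apply hX' h01 h10; linear_combination -h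
      refine ⟨Y 0 0 - (Y 0 0 - Y 1 1) / (X 0 0 - X 1 1) * X 0 0,
        (Y 0 0 - Y 1 1) / (X 0 0 - X 1 1), ?_, ?_, ?_, ?_⟩ <;> simp <;> field_simp <;> grind
    · refine ⟨Y 0 0 - Y 1 0 / X 1 0 * X 0 0,
        Y 1 0 / X 1 0, ?_, ?_, ?_, ?_⟩ <;> simp <;> field_simp <;> grind
  · refine ⟨Y 0 0 - Y 0 1 / X 0 1 * X 0 0,
        Y 0 1 / X 0 1, ?_, ?_, ?_, ?_⟩ <;> simp <;> field_simp <;> grind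

theorem sl2_ext_iff (g h : SL2 F) : g = h ↔ g.1 = h.1 := Subtype.ext_iff

/-- `g` is `1` or `-1`. -/
def IsPM (g : SL2 F) : Prop := g = 1 ∨ g = -1

theorem isPM_of_scalar (g : SL2 F) (r : F) (h : g.1 = r • 1) : IsPM g := by
  have hd := sl2_det g
  simp only [IsPM, sl2_ext_iff]
  simp [h] at hd
  have : (r - 1) * (r + 1) = 0 := by linear_combination hd
  rcases mul_eq_zero.1 this with h1 | h1
  · left; rw [h, sub_eq_zero.1 h1]; simp
  · right; rw [h, eq_neg_of_add_eq_zero_left h1]; simp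

/-- The matrix `E₁₂`. -/
def E12 : M2 F := !![0, 1; 0, 0]

/-- The stabilizer of the line spanned by `n` under conjugation. -/
def LStab (n : M2 F) : Subgroup (SL2 F) where
  carrier := {g | ∃ l : F, g.1 * n = l • (n * g.1)}
  one_mem' := ⟨1, by simp⟩
  mul_mem' := by
    rintro a b ⟨l, hl⟩ ⟨k, hk⟩
    refine ⟨k * l, ?_⟩
    have : (a * b).1 = a.1 * b.1 := rfl
    rw [this, mul_assoc, hk, Matrix.mul_smul, ← mul_assoc, hl, Matrix.smul_mul, smul_smul, mul_assoc]
  inv_mem' := by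
    rintro a ⟨l, hl⟩
    have h1 : a.1 * (a⁻¹).1 = 1 := congrArg Subtype.val (mul_inv_cancel a)
    have h2 : (a⁻¹).1 * a.1 = 1 := congrArg Subtype.val (inv_mul_cancel a)
    have h3 : n * (a⁻¹).1 = l • ((a⁻¹).1 * n) := by
      calc n * (a⁻¹).1 = (a⁻¹).1 * (a.1 * n) * (a⁻¹).1 := by rw [← mul_assoc, h2, one_mul]
        _ = l • ((a⁻¹).1 * n) * (a.1 * (a⁻¹).1) := by
          rw [hl, Matrix.mul_smul, Matrix.smul_mul, Matrix.smul_mul]; simp only [mul_assoc]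
        _ = _ := by rw [h1, mul_one]
    by_cases hl0 : l = 0
    · refine ⟨0, ?_⟩
      rw [hl0, zero_smul] at h3
      have : n = 0 := by
        calc n = n * ((a⁻¹).1 * a.1) := by rw [h2, mul_one]
          _ = 0 := by rw [← mul_assoc, h3, zero_mul]
      simp [this]
    · exact ⟨l⁻¹, by rw [h3, smul_smul, inv_mul_cancel₀ hl0, one_smul]⟩

theorem mem_LStab {n : M2 F} {g : SL2 F} : g ∈ LStab n ↔ ∃ l : F, g.1 * n = l • (n * g.1) :=
  Iff.rfl

theorem LStab_smul {n : M2 F} {c : F} (hc : c ≠ 0) : LStab (c • n) = LStab n := by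
  ext g
  simp only [mem_LStab]
  refine exists_congr fun l => ?_
  rw [Matrix.mul_smul, Matrix.smul_mul, smul_comm l c]
  exact (smul_right_injective _ hc).eq_iff

/-- Conjugating. -/
theorem LStab_conj {n n' : M2 F} {P g : SL2 F} (h : P.1 * n = n' * P.1) :
    g ∈ LStab n ↔ P * g * P⁻¹ ∈ LStab n' := by
  have h1 : P.1 * (P⁻¹).1 = 1 := congrArg Subtype.val (mul_inv_cancel P)
  have h2 : (P⁻¹).1 * P.1 = 1 := congrArg Subtype.val (inv_mul_cancel P)
  have hn' : n' = P.1 * n * (P⁻¹).1 := by rw [h, mul_assoc, h1, mul_one]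
  have e : (P * g * P⁻¹).1 = P.1 * g.1 * (P⁻¹).1 := rfl
  have e1 : (P * g * P⁻¹).1 * n' = P.1 * (g.1 * n) * (P⁻¹).1 := by
    rw [e, hn']
    calc _ = P.1 * g.1 * ((P⁻¹).1 * P.1) * n * (P⁻¹).1 := by simp only [mul_assoc]
      _ = _ := by rw [h2]; simp only [mul_assoc, mul_one]
  have e2 : n' * (P * g * P⁻¹).1 = P.1 * (n * g.1) * (P⁻¹).1 := by
    rw [e, hn']
    calc _ = P.1 * n * ((P⁻¹).1 * P.1) * g.1 * (P⁻¹).1 := by simp only [mul_assoc]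
      _ = _ := by rw [h2]; simp only [mul_assoc, mul_one]
  simp only [mem_LStab]
  refine exists_congr fun l => ?_
  rw [e1, e2]
  constructor
  · intro h; rw [h]; simp
  · intro h
    have := congrArg (fun z => (P⁻¹).1 * z * P.1) h
    simp only [mul_assoc, h2, mul_one, Matrix.smul_mul, Matrix.mul_smul] at this
    simpa only [← mul_assoc, h2, one_mul] using this

theorem exists_conj_E12 (n : M2 F) (hn : n ≠ 0) (ht : n.trace = 0) (hd : n.det = 0) :
    ∃ (P : SL2 F) (c : F), c ≠ 0 ∧ P.1 * n = (c • E12) * P.1 := by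
  rw [m2_tr] at ht
  rw [m2_det] at hd
  have h11 : n 1 1 = - n 0 0 := by linear_combination ht
  rw [h11] at hd
  by_cases hw : n 1 0 = 0
  · have h00 : n 0 0 = 0 := by
      rw [hw] at hd
      have : n 0 0 * n 0 0 = 0 := by linear_combination -hd
      simpa using this
    refine ⟨1, n 0 1, ?_, ?_⟩
    · intro h; apply hn; simp [m2_ext_iff, h, h11, h00, hw]
    · simp [m2_ext_iff, E12, hw, h11, h00]
  · refine ⟨⟨!![0, -(n 1 0)⁻¹; n 1 0, - n 0 0], by simp [m2_det, hw]⟩, -(n 1 0)⁻¹,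
      by simpa using hw, ?_⟩
    simp only [m2_ext_iff, m2_mul]
    simp [E12, hw, h11]
    grind

theorem mem_LStab_E12 {g : SL2 F} : g ∈ LStab (E12 : M2 F) ↔ g.1 1 0 = 0 := by
  have hd := sl2_det g
  constructor
  · rintro ⟨l, hl⟩
    simp only [m2_ext_iff, m2_mul, Matrix.smul_apply] at hl
    simp [E12] at hl
    grind
  · intro h
    refine ⟨g.1 0 0 ^ 2, ?_⟩
    simp only [m2_ext_iff, m2_mul, Matrix.smul_apply]
    simp [E12, h]
    grind

end basics

section frames
variable {F : Type*} [Field F]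

theorem sl2_mul_val (g h : SL2 F) : (g * h).1 = g.1 * h.1 := rfl
theorem sl2_neg_val (g : SL2 F) : (-g).1 = -g.1 := Matrix.SpecialLinearGroup.coe_neg g
theorem sl2_one_val : (1 : SL2 F).1 = 1 := rfl

theorem tr_conj (g h : SL2 F) : (g * h * g⁻¹).1.trace = h.1.trace := by
  rw [sl2_mul_val, Matrix.trace_mul_comm, ← sl2_mul_val]
  have : g⁻¹ * (g * h) = h := by group
  rw [this]

theorem sq_of_tr_zero {a : SL2 F} (ha : a.1.trace = 0) : a * a = -1 := by
  have hd := sl2_det a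
  rw [m2_tr] at ha
  rw [sl2_ext_iff, sl2_mul_val, sl2_neg_val, m2_ext_iff]
  simp only [m2_mul]
  simp
  grind

theorem nonscalar_of_tr_zero (h2 : (2 : F) ≠ 0) {a : SL2 F} (ha : a.1.trace = 0) (r : F) :
    a.1 ≠ r • 1 := by
  intro h
  have hd := sl2_det a
  rw [m2_tr] at ha
  simp [h] at hd ha
  have : (2 : F) * r = 0 := by linear_combination ha
  have : r = 0 := by simpa [h2] using this
  simp [this] at hd

theorem nonscalar_of_not_isPM {a : SL2 F} (ha : ¬ IsPM a) (r : F) : a.1 ≠ r • 1 :=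
  fun h => ha (isPM_of_scalar a r h)

theorem not_isPM_of_tr_zero (h2 : (2 : F) ≠ 0) {a : SL2 F} (ha : a.1.trace = 0) : ¬ IsPM a := by
  rintro (h | h)
  · exact nonscalar_of_tr_zero h2 ha 1 (by rw [h]; simp)
  · exact nonscalar_of_tr_zero h2 ha (-1) (by rw [h]; simp)

/-- equality up to sign -/
def PMEq (g h : SL2 F) : Prop := g = h ∨ g = -h

theorem PMEq.symm {g h : SL2 F} (H : PMEq g h) : PMEq h g := by
  rcases H with rfl | rfl
  · exact Or.inl rfl
  · exact Or.inr (by simp)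

theorem PMEq.trans {g h k : SL2 F} (H : PMEq g h) (H' : PMEq h k) : PMEq g k := by
  rcases H with rfl | rfl <;> rcases H' with rfl | rfl <;> simp [PMEq]

theorem PMEq.conj {g h : SL2 F} (k : SL2 F) (H : PMEq g h) : PMEq (k * g * k⁻¹) (k * h * k⁻¹) := by
  rcases H with rfl | rfl
  · exact Or.inl rfl
  · exact Or.inr (by simp)

theorem PMEq.mul {g h g' h' : SL2 F} (H : PMEq g h) (H' : PMEq g' h') : PMEq (g * g') (h * h') := by
  rcases H with rfl | rfl <;> rcases H' with rfl | rfl <;> simp [PMEq]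

theorem PMEq.of_conj {g h : SL2 F} (k : SL2 F) (H : PMEq (k * g * k⁻¹) (k * h * k⁻¹)) :
    PMEq g h := by
  have := H.conj k⁻¹
  have e : ∀ x : SL2 F, k⁻¹ * (k * x * k⁻¹) * k⁻¹⁻¹ = x := fun x => by group
  rwa [e, e] at this

theorem comm_tr_zero (h2 : (2 : F) ≠ 0) {a g : SL2 F} (ha : a.1.trace = 0) (hg : g.1.trace = 0)
    (h : a * g = g * a) : PMEq g a := by
  obtain ⟨α, β, hh⟩ := commutant a.1 g.1 (by rw [← sl2_mul_val, h, sl2_mul_val])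
    (nonscalar_of_tr_zero h2 ha)
  have hd := sl2_det g
  have hda := sl2_det a
  have ht : (2 : F) * α = 0 := by
    rw [hh] at hg; rw [Matrix.trace_add, Matrix.trace_smul, Matrix.trace_smul, ha] at hg
    simp at hg; simpa [h2] using hg
  have hα : α = 0 := by simpa [h2] using ht
  rw [hα, zero_smul, zero_add] at hh
  rw [hh] at hd
  simp at hd
  have : (β - 1) * (β + 1) = 0 := by linear_combination hd - β ^ 2 * hda
  rcases mul_eq_zero.1 this with h1 | h1
  · left; rw [sl2_ext_iff, hh, sub_eq_zero.1 h1]; simp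
  · right; rw [sl2_ext_iff, hh, eq_neg_of_add_eq_zero_left h1]; simp

theorem tr_neg (g : SL2 F) : (-g).1.trace = - g.1.trace := by rw [sl2_neg_val, Matrix.trace_neg]

theorem anti_tr (h2 : (2 : F) ≠ 0) {g h : SL2 F} (H : g * h = -(h * g)) : g.1.trace = 0 := by
  have : h⁻¹ * g * h⁻¹⁻¹ = -g := by
    rw [inv_inv, mul_assoc, H]; simp
  have h3 := tr_conj h⁻¹ g
  rw [this, tr_neg] at h3
  have : (2 : F) * g.1.trace = 0 := by linear_combination -h3
  simpa [h2] using this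

theorem anti_symm {g h : SL2 F} (H : g * h = -(h * g)) : h * g = -(g * h) := by rw [H]; simp

theorem anti_mul_tr (h2 : (2 : F) ≠ 0) {g h : SL2 F} (H : g * h = -(h * g)) :
    (g * h).1.trace = 0 := by
  have h3 : (g * h).1.trace = (h * g).1.trace := by
    rw [sl2_mul_val, Matrix.trace_mul_comm, ← sl2_mul_val]
  rw [H, tr_neg] at h3
  rw [H, tr_neg]
  have : (2 : F) * (h * g).1.trace = 0 := by linear_combination -h3
  simpa [h2] using this

theorem not_comm_and_anti (h2 : (2 : F) ≠ 0) {g h : SL2 F} (H : g * h = -(h * g))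
    (H' : g * h = h * g) : False := by
  have h3 := congrArg (fun z => z.1) (H.symm.trans H')
  simp only [sl2_neg_val] at h3
  have h4 : (2 : F) • (h * g).1 = 0 := by rw [two_smul]; nth_rw 1 [← h3]; simp
  have h5 : (h * g).1 = 0 := by simpa [h2] using h4
  have := sl2_det (h * g)
  rw [h5] at this; simp at this

/-- A pair of anticommuting elements of order four. -/
def IsFrame (a b : SL2 F) : Prop := a.1.trace = 0 ∧ b.1.trace = 0 ∧ a * b = -(b * a)

/-- The six noncentral elements of the quaternion group generated by `a, b`. -/
def Fr (a b : SL2 F) : Set (SL2 F) := {x | PMEq x a ∨ PMEq x b ∨ PMEq x (a * b)}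

/-- The stabilizer of a frame. -/
def FStab (a b : SL2 F) : Subgroup (SL2 F) := Subgroup.normalizer (Fr a b)

theorem PMEq.tr_zero {g h : SL2 F} (H : PMEq g h) (hh : h.1.trace = 0) : g.1.trace = 0 := by
  rcases H with rfl | rfl
  · exact hh
  · rw [tr_neg, hh, neg_zero]

theorem IsFrame.tr_c (h2 : (2 : F) ≠ 0) {a b : SL2 F} (h : IsFrame a b) : (a * b).1.trace = 0 :=
  anti_mul_tr h2 h.2.2

theorem Fr_tr (h2 : (2 : F) ≠ 0) {a b x : SL2 F} (h : IsFrame a b) (hx : x ∈ Fr a b) :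
    x.1.trace = 0 := by
  rcases hx with hx | hx | hx
  · exact hx.tr_zero h.1
  · exact hx.tr_zero h.2.1
  · exact hx.tr_zero (h.tr_c h2)

theorem IsFrame.rot (h2 : (2 : F) ≠ 0) {a b : SL2 F} (h : IsFrame a b) : IsFrame b (a * b) ∧
    b * (a * b) = a := by
  have hb := sq_of_tr_zero h.2.1
  have e : b * (a * b) = a := by
    rw [← mul_assoc, anti_symm h.2.2, neg_mul, mul_assoc, hb]; simp
  refine ⟨⟨h.2.1, h.tr_c h2, ?_⟩, e⟩
  rw [e, mul_assoc, hb]; simp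

theorem Fr_rot (h2 : (2 : F) ≠ 0) {a b : SL2 F} (h : IsFrame a b) : Fr b (a * b) = Fr a b := by
  ext x
  simp only [Fr, Set.mem_ofPred_eq, (h.rot h2).2]
  tauto

/-- An element normalizing both lines is in the quaternion group. -/
theorem frame_fin (h2 : (2 : F) ≠ 0) {a b g : SL2 F} (h : IsFrame a b)
    (ha : g * a = a * g ∨ g * a = -(a * g)) (hb : g * b = b * g ∨ g * b = -(b * g)) :
    IsPM g ∨ g ∈ Fr a b := by
  rcases ha with ha | ha
  · rcases hb with hb | hb
    · left
      by_contra hg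
      obtain ⟨α, β, e1⟩ := commutant g.1 a.1 (congrArg Subtype.val ha) (nonscalar_of_not_isPM hg)
      obtain ⟨γ, δ, e2⟩ := commutant g.1 b.1 (congrArg Subtype.val hb) (nonscalar_of_not_isPM hg)
      refine not_comm_and_anti h2 h.2.2 ?_
      rw [sl2_ext_iff, sl2_mul_val, sl2_mul_val, e1, e2]
      simp only [mul_add, add_mul, Matrix.smul_mul, Matrix.mul_smul, smul_smul, one_mul, mul_one]
      simp only [mul_comm]
      abel
    · right; left
      exact comm_tr_zero h2 h.1 (anti_tr h2 hb) ha.symm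
  · rcases hb with hb | hb
    · right; right; left
      exact comm_tr_zero h2 h.2.1 (anti_tr h2 ha) hb.symm
    · right; right; right
      refine comm_tr_zero h2 (h.tr_c h2) (anti_tr h2 ha) ?_
      rw [← mul_assoc g, ha, neg_mul, mul_assoc a g, hb]; simp [mul_assoc]

theorem conj_pm {g a : SL2 F} (h : PMEq (g * a * g⁻¹) a) : g * a = a * g ∨ g * a = -(a * g) := by
  rcases h with h | h
  · left; rw [mul_inv_eq_iff_eq_mul] at h; exact h
  · right; rw [mul_inv_eq_iff_eq_mul] at h; rw [h]; simp

theorem pm_conj {g a : SL2 F} (h : g * a = a * g ∨ g * a = -(a * g)) : PMEq (g * a * g⁻¹) a := by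
  rcases h with h | h
  · left; rw [mul_inv_eq_iff_eq_mul]; exact h
  · right; rw [mul_inv_eq_iff_eq_mul, h]; simp

theorem not_pm_of_anti (h2 : (2 : F) ≠ 0) {a b : SL2 F} (h : a * b = -(b * a)) : ¬ PMEq a b := by
  rintro (rfl | rfl)
  · exact not_comm_and_anti h2 h rfl
  · exact not_comm_and_anti h2 h (by simp)

theorem frame_no_swap (h3 : (3 : F) = 0) (hsq : ∀ r : F, r * r ≠ -1) {a b g : SL2 F}
    (h : IsFrame a b) (ha : g * a = a * g) (hb : PMEq (g * b * g⁻¹) (a * b)) : False := by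
  have h2 : (2 : F) ≠ 0 := by
    intro h; exact one_ne_zero (α := F) (by linear_combination h3 - h)
  obtain ⟨α, β, e⟩ := commutant a.1 g.1 (congrArg Subtype.val ha.symm) (nonscalar_of_tr_zero h2 h.1)
  have hda := sl2_det a
  have hdg := sl2_det g
  have hta := h.1
  rw [m2_tr] at hta
  rw [e] at hdg
  simp at hdg
  have hdet : α * α + β * β = 1 := by
    linear_combination hdg - α * β * hta - β * β * hda
  have key : ∀ ε : F, ε * ε = 1 → g.1 * b.1 = ε • (a.1 * b.1 * g.1) → False := by
    intro ε hε hh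
    have haa : a.1 * a.1 = -1 := by
      rw [← sl2_mul_val, sq_of_tr_zero h.1]; simp
    have hab : a.1 * b.1 = -(b.1 * a.1) := by
      rw [← sl2_mul_val, h.2.2]; simp
    have haba : a.1 * b.1 * a.1 = b.1 := by
      rw [hab, neg_mul, mul_assoc, haa]; simp
    have hb1 : b.1 * (b⁻¹).1 = 1 := congrArg Subtype.val (mul_inv_cancel b)
    have h5 : ((α - ε * β) • (1 : M2 F) + (β - ε * α) • a.1) * b.1 = 0 := by
      rw [e] at hh
      simp only [add_mul, mul_add, Matrix.smul_mul, Matrix.mul_smul, one_mul, mul_one, haba] at hh ⊢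
      rw [sub_smul, sub_smul, mul_smul, mul_smul]
      rw [smul_add] at hh
      have : ε • α • (a.1 * b.1) + ε • β • b.1 = α • b.1 + β • (a.1 * b.1) := hh.symm
      calc _ = (α • b.1 + β • (a.1 * b.1)) - (ε • α • (a.1 * b.1) + ε • β • b.1) := by abel
        _ = 0 := by rw [this, sub_self]
    have h6 : (α - ε * β) • (1 : M2 F) + (β - ε * α) • a.1 = 0 := by
      calc _ = ((α - ε * β) • (1 : M2 F) + (β - ε * α) • a.1) * (b.1 * (b⁻¹).1) := by
            rw [hb1, mul_one]
        _ = 0 := by rw [← mul_assoc, h5, zero_mul]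
    have h7 := congrArg Matrix.trace h6
    rw [Matrix.trace_add, Matrix.trace_smul, Matrix.trace_smul, h.1] at h7
    simp [h2] at h7
    apply hsq α
    have : α * α = β * β := by linear_combination (α + ε * β) * h7 + β * β * hε
    linear_combination (-1) * hdet + α * α * h3 - this
  rcases hb with hb | hb
  · refine key 1 (by simp) ?_
    rw [mul_inv_eq_iff_eq_mul] at hb
    rw [one_smul]; exact congrArg Subtype.val hb
  · refine key (-1) (by simp) ?_
    rw [mul_inv_eq_iff_eq_mul] at hb
    have := congrArg Subtype.val hb
    rw [neg_mul, sl2_neg_val] at this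
    rw [neg_smul, one_smul]; exact this

theorem two_ne_of_three (h3 : (3 : F) = 0) : (2 : F) ≠ 0 := by
  intro h; exact one_ne_zero (α := F) (by linear_combination h3 - h)

theorem Fr_conj {a b g x : SL2 F} (hg : g ∈ FStab a b) (hx : x ∈ Fr a b) :
    g * x * g⁻¹ ∈ Fr a b := (Subgroup.mem_set_normalizer_iff.1 hg x).1 hx

theorem frame_line (h3 : (3 : F) = 0) (hsq : ∀ r : F, r * r ≠ -1) {a b g : SL2 F}
    (h : IsFrame a b) (hg : g ∈ FStab a b) (ha : PMEq (g * a * g⁻¹) a) :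
    IsPM g ∨ g ∈ Fr a b := by
  have h2 := two_ne_of_three h3
  have hb := Fr_conj hg (x := b) (Or.inr (Or.inl (Or.inl rfl)))
  have ha' := conj_pm ha
  rcases hb with hb | hb | hb
  · exact absurd (PMEq.of_conj g (ha.trans hb.symm)) (not_pm_of_anti h2 h.2.2)
  · exact frame_fin h2 h ha' (conj_pm hb)
  · exfalso
    rcases ha' with ha' | ha'
    · exact frame_no_swap h3 hsq h ha' hb
    · refine frame_no_swap h3 hsq (g := g * b) h ?_ ?_
      · rw [mul_assoc, anti_symm h.2.2, mul_neg, ← mul_assoc, ha']; simp [mul_assoc]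
      · convert hb using 1; group

theorem frame_tr (h3 : (3 : F) = 0) (hsq : ∀ r : F, r * r ≠ -1) {a b g : SL2 F}
    (h : IsFrame a b) (hg : g ∈ FStab a b) : g.1.trace * g.1.trace = 1 ∨ g ∈ Fr a b := by
  have h2 := two_ne_of_three h3
  have hpm : ∀ k : SL2 F, IsPM k → k.1.trace * k.1.trace = 1 := by
    rintro k (rfl | rfl)
    · simp; linear_combination h3
    · rw [tr_neg]; simp; linear_combination h3
  have r1 := h.rot h2
  have r2 := r1.1.rot h2
  have f1 := Fr_rot h2 h
  have f2 := (Fr_rot h2 r1.1).trans f1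
  rw [r1.2] at r2 f2
  have L : ∀ k ∈ FStab a b, ∀ x ∈ Fr a b, PMEq (k * x * k⁻¹) x → IsPM k ∨ k ∈ Fr a b := by
    intro k hk x hx hx'
    rcases hx with hx | hx | hx
    · exact frame_line h3 hsq h hk ((hx.symm.conj k).trans (hx'.trans hx))
    · rw [← f1]
      exact frame_line h3 hsq r1.1 (by rw [FStab, f1]; exact hk)
        ((hx.symm.conj k).trans (hx'.trans hx))
    · rw [← f2]
      exact frame_line h3 hsq r2.1 (by rw [FStab, f2]; exact hk)
        ((hx.symm.conj k).trans (hx'.trans hx))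
  have L' : ∀ x ∈ Fr a b, PMEq (g * x * g⁻¹) x → g.1.trace * g.1.trace = 1 ∨ g ∈ Fr a b :=
    fun x hx hx' => (L g hg x hx hx').imp_left (hpm g)
  have ma : a ∈ Fr a b := Or.inl (Or.inl rfl)
  have mb : b ∈ Fr a b := Or.inr (Or.inl (Or.inl rfl))
  have mc : a * b ∈ Fr a b := Or.inr (Or.inr (Or.inl rfl))
  have cube : PMEq (g * (g * (g * a * g⁻¹) * g⁻¹) * g⁻¹) a →
      g.1.trace * g.1.trace = 1 ∨ g ∈ Fr a b := by
    intro hc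
    have e : g * (g * (g * a * g⁻¹) * g⁻¹) * g⁻¹ = (g * g * g) * a * (g * g * g)⁻¹ := by group
    rw [e] at hc
    rcases L (g * g * g) (mul_mem (mul_mem hg hg) hg) a ma hc with hh | hh
    · left
      by_contra ht
      have hd := sl2_det g
      have : ∃ r : F, g.1 * g.1 * g.1 = r • 1 := by
        rcases hh with hh | hh
        · exact ⟨1, by rw [one_smul]; exact congrArg Subtype.val hh⟩
        · exact ⟨-1, by have := congrArg Subtype.val hh; rw [sl2_neg_val] at this; simpa using this⟩
      obtain ⟨r, hr⟩ := this
      have hs : (g.1.trace * g.1.trace - 1) • g.1 = (r + g.1.trace) • 1 := by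
        rw [m2_ext_iff] at hr ⊢
        simp only [m2_mul, Matrix.smul_apply, m2_tr] at hr ⊢
        simp at hr ⊢
        grind
      have ht' : g.1.trace * g.1.trace - 1 ≠ 0 := sub_ne_zero.2 ht
      apply ht
      apply hpm
      apply isPM_of_scalar g ((g.1.trace * g.1.trace - 1)⁻¹ * (r + g.1.trace))
      rw [mul_smul, ← hs, smul_smul, inv_mul_cancel₀ ht', one_smul]
    · exact L' _ hh (Or.inl (by group))
  have ca := Fr_conj hg ma
  have cb := Fr_conj hg mb
  have cc := Fr_conj hg mc
  have hab := not_pm_of_anti h2 h.2.2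
  have hbc := not_pm_of_anti h2 r1.1.2.2
  have hca := not_pm_of_anti h2 r2.1.2.2
  rcases ca with ca | ca | ca
  · exact L' _ ma ca
  · rcases cb with cb | cb | cb
    · rcases cc with cc | cc | cc
      · exact absurd (PMEq.of_conj g (cb.trans cc.symm)) hbc
      · exact absurd (PMEq.of_conj g (cc.trans ca.symm)) hca
      · exact L' _ mc cc
    · exact absurd (PMEq.of_conj g (ca.trans cb.symm)) hab
    · rcases cc with cc | cc | cc
      · exact cube ((((ca.conj g).conj g).trans (cb.conj g)).trans cc)
      · exact absurd (PMEq.of_conj g (cc.trans ca.symm)) hca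
      · exact L' _ mc cc
  · rcases cb with cb | cb | cb
    · rcases cc with cc | cc | cc
      · exact absurd (PMEq.of_conj g (cb.trans cc.symm)) hbc
      · exact cube ((((ca.conj g).conj g).trans (cc.conj g)).trans cb)
      · exact L' _ mc cc
    · exact L' _ mb cb
    · exact absurd (PMEq.of_conj g (ca.trans cb.symm)) hab

end frames

section structure_thm
variable {F : Type*} [Field F]

theorem IsPM.comm {z : SL2 F} (h : IsPM z) (g : SL2 F) : z * g = g * z := by
  rcases h with rfl | rfl <;> simp

theorem isPM_conj {x g : SL2 F} : IsPM (g * x * g⁻¹) ↔ IsPM x := by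
  have : ∀ x g : SL2 F, IsPM x → IsPM (g * x * g⁻¹) := by
    rintro x g (rfl | rfl) <;> simp [IsPM]
  refine ⟨fun h => ?_, this x g⟩
  have := this _ g⁻¹ h
  have e : g⁻¹ * (g * x * g⁻¹) * g⁻¹⁻¹ = x := by group
  rwa [e] at this

theorem structure_core (h2 : (2 : F) ≠ 0) (H A : Subgroup (SL2 F))
    (hA : ∀ g ∈ H, ∀ a ∈ A, g * a * g⁻¹ ∈ A)
    (hcomm : ∀ a ∈ A, ∀ b ∈ A, a * b = b * a ∨ a * b = -(b * a))
    (a : SL2 F) (haA : a ∈ A) (ha : ¬ IsPM a) :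
    (∃ n : M2 F, n ≠ 0 ∧ n.trace = 0 ∧ H ≤ LStab n) ∨ ∃ a b, IsFrame a b ∧ H ≤ FStab a b := by
  by_cases hex : ∃ g ∈ A, ¬ IsPM g ∧ g.1.trace ≠ 0
  · left
    obtain ⟨g, hgA, hg, ht⟩ := hex
    have hns := nonscalar_of_not_isPM hg
    refine ⟨g.1 - (g.1.trace / 2) • 1, sub_ne_zero.2 (hns _), ?_, ?_⟩
    · rw [Matrix.trace_sub, Matrix.trace_smul]; simp; field_simp; simp
    · intro h hh
      set k := h * g * h⁻¹ with hk
      have hkA : k ∈ A := hA h hh g hgA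
      have hgk : g * k = k * g := by
        rcases hcomm g hgA k hkA with h1 | h1
        · exact h1
        · exact absurd (anti_tr h2 h1) ht
      obtain ⟨α, β, e⟩ := commutant g.1 k.1 (congrArg Subtype.val hgk) hns
      have htk : k.1.trace = g.1.trace := tr_conj h g
      refine ⟨β, ?_⟩
      have e1 : h.1 * g.1 = k.1 * h.1 := by
        rw [← sl2_mul_val, ← sl2_mul_val, hk, inv_mul_cancel_right]
      rw [e, Matrix.trace_add, Matrix.trace_smul, Matrix.trace_smul] at htk
      simp at htk
      have hα : α = (1 - β) * (g.1.trace / 2) := by field_simp; linear_combination htk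
      have e2 : h.1 * g.1 = α • h.1 + β • (g.1 * h.1) := by
        rw [e1, e, add_mul, Matrix.smul_mul, Matrix.smul_mul, one_mul]
      rw [mul_sub, e2, sub_mul, smul_sub, hα, Matrix.mul_smul, Matrix.smul_mul, one_mul, mul_one,
        smul_smul, sub_mul, one_mul, sub_smul]
      abel
  · push Not at hex
    have hta := hex a haA ha
    by_cases hb : ∃ b ∈ A, ¬ IsPM b ∧ ¬ PMEq b a
    · right
      obtain ⟨b, hbA, hb, hba⟩ := hb
      have htb := hex b hbA hb
      have hab : a * b = -(b * a) := by
        rcases hcomm a haA b hbA with h | h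
        · exact absurd (comm_tr_zero h2 hta htb h) hba
        · exact h
      have hf : IsFrame a b := ⟨hta, htb, hab⟩
      refine ⟨a, b, hf, ?_⟩
      have hneg : (-1 : SL2 F) ∈ A := by rw [← sq_of_tr_zero hta]; exact mul_mem haA haA
      have hpm : ∀ x y : SL2 F, PMEq x y → y ∈ A → x ∈ A := by
        rintro x y (rfl | rfl) hy
        · exact hy
        · have := mul_mem hneg hy; simpa using this
      have hset : ∀ x, x ∈ Fr a b ↔ x ∈ A ∧ ¬ IsPM x := by
        intro x
        constructor
        · intro hx
          refine ⟨?_, not_isPM_of_tr_zero h2 (Fr_tr h2 hf hx)⟩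
          rcases hx with hx | hx | hx
          · exact hpm _ _ hx haA
          · exact hpm _ _ hx hbA
          · exact hpm _ _ hx (mul_mem haA hbA)
        · rintro ⟨hxA, hx⟩
          exact (frame_fin h2 hf (hcomm x hxA a haA) (hcomm x hxA b hbA)).resolve_left hx
      intro g hg
      refine Subgroup.mem_set_normalizer_iff.2 fun x => ?_
      rw [hset, hset, isPM_conj]
      refine and_congr_left fun _ => ⟨hA g hg x, fun h => ?_⟩
      have := hA g⁻¹ (inv_mem hg) _ h
      have e : g⁻¹ * (g * x * g⁻¹) * g⁻¹⁻¹ = x := by group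
      rwa [e] at this
    · left
      push Not at hb
      refine ⟨a.1, ?_, hta, ?_⟩
      · intro h0; have := sl2_det a; rw [h0] at this; simp at this
      · intro g hg
        have := conj_pm (hb _ (hA g hg a haA) (by rwa [isPM_conj]))
        rcases this with h | h
        · exact ⟨1, by rw [one_smul]; exact congrArg Subtype.val h⟩
        · refine ⟨-1, ?_⟩
          have := congrArg Subtype.val h
          rw [sl2_neg_val] at this
          rw [neg_smul, one_smul]; exact this

theorem structure_thm (h2 : (2 : F) ≠ 0) (H : Subgroup (SL2 F)) (hs : Group.IsSolvable H) :
    (∃ n : M2 F, n ≠ 0 ∧ n.trace = 0 ∧ H ≤ LStab n) ∨ ∃ a b, IsFrame a b ∧ H ≤ FStab a b := by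
  classical
  by_cases hH : ∀ g ∈ H, IsPM g
  · left
    refine ⟨E12, ?_, ?_, ?_⟩
    · intro h; have := congrFun (congrFun h 0) 1; simp [E12] at this
    · simp [E12, m2_tr]
    · intro g hg
      rw [mem_LStab_E12]
      rcases hH g hg with rfl | rfl
      · simp
      · simp
  · have hex : ∃ k, ∀ g ∈ derivedSeries H k, IsPM g.1 := by
      obtain ⟨k, hk⟩ := (Group.isSolvable_def H).1 hs
      refine ⟨k, fun g hg => ?_⟩
      rw [hk, Subgroup.mem_bot] at hg
      rw [hg]; left; rfl
    obtain ⟨k, hk⟩ : ∃ k, Nat.find hex = k + 1 := by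
      refine Nat.exists_eq_succ_of_ne_zero fun h0 => hH fun g hg => ?_
      have := Nat.find_spec hex
      rw [h0] at this
      exact this ⟨g, hg⟩ (by simp)
    have hk1 := Nat.find_spec hex
    have hk0 := Nat.find_min hex (m := k) (by omega)
    rw [hk, derivedSeries_succ] at hk1
    push Not at hk0
    obtain ⟨a, haA, ha⟩ := hk0
    refine structure_core h2 H ((derivedSeries H k).map H.subtype) ?_ ?_ a.1 ⟨a, haA, rfl⟩ ha
    · rintro g hg _ ⟨b, hb, rfl⟩
      have h1 := (derivedSeries_normal H k).conj_mem b hb ⟨g, hg⟩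
      exact Subgroup.mem_map_of_mem H.subtype h1
    · rintro _ ⟨b, hb, rfl⟩ _ ⟨c, hc, rfl⟩
      have : IsPM (b.1 * c.1 * b.1⁻¹ * c.1⁻¹) :=
        hk1 _ (Subgroup.commutator_mem_commutator hb hc)
      rcases this with h | h
      · left
        rw [mul_inv_eq_one, mul_inv_eq_iff_eq_mul] at h
        exact h
      · right
        rw [mul_inv_eq_iff_eq_mul, mul_inv_eq_iff_eq_mul] at h
        change b.1 * c.1 = -(c.1 * b.1)
        rw [h]; simp

end structure_thm

section borel
variable {F : Type*} [Field F]

/-- Upper unitriangular matrices. -/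
def UU (t : F) : SL2 F := ⟨!![1, t; 0, 1], by simp [m2_det]⟩

/-- Lower unitriangular matrices. -/
def LL (t : F) : SL2 F := ⟨!![1, 0; t, 1], by simp [m2_det]⟩

@[simp] theorem UU_val (t : F) : (UU t).1 = !![1, t; 0, 1] := rfl
@[simp] theorem LL_val (t : F) : (LL t).1 = !![1, 0; t, 1] := rfl

theorem UU_mul (s t : F) : UU s * UU t = UU (s + t) := by
  rw [sl2_ext_iff, sl2_mul_val, m2_ext_iff]
  simp only [m2_mul]; simp [add_comm]

theorem UU_inv (t : F) : (UU t)⁻¹ = UU (-t) := by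
  rw [inv_eq_iff_mul_eq_one, UU_mul, sl2_ext_iff, m2_ext_iff]; simp

theorem UU_eq_one (t : F) : UU t = 1 ↔ t = 0 := by
  rw [sl2_ext_iff, m2_ext_iff]; simp

theorem LL_mul (s t : F) : LL s * LL t = LL (s + t) := by
  rw [sl2_ext_iff, sl2_mul_val, m2_ext_iff]
  simp only [m2_mul]; simp

theorem gen_top (H : Subgroup (SL2 F)) (hU : ∀ t, UU t ∈ H) (g : SL2 F) (hg : g ∈ H)
    (hg0 : g.1 1 0 ≠ 0) : H = ⊤ := by
  have hL : ∀ t, LL t ∈ H := by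
    intro t
    have hd := sl2_det g
    obtain ⟨w, hw⟩ : ∃ w : SL2 F, w = UU (-(g.1 0 0) / g.1 1 0) * g * UU (-(g.1 1 1) / g.1 1 0) :=
      ⟨_, rfl⟩
    have hwH : w ∈ H := by rw [hw]; exact mul_mem (mul_mem (hU _) hg) (hU _)
    have hwv : w.1 = !![0, -(g.1 1 0)⁻¹; g.1 1 0, 0] := by
      rw [hw, sl2_mul_val, sl2_mul_val, m2_ext_iff]
      simp only [m2_mul]
      simp
      grind
    have e : LL t * w = w * UU (-t / (g.1 1 0) ^ 2) := by
      rw [sl2_ext_iff, sl2_mul_val, sl2_mul_val, hwv, m2_ext_iff]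
      simp only [m2_mul]
      simp
      grind
    have e2 : LL t = w * UU (-t / (g.1 1 0) ^ 2) * w⁻¹ := by rw [← e, mul_inv_cancel_right]
    rw [e2]
    exact mul_mem (mul_mem hwH (hU _)) (inv_mem hwH)
  have key : ∀ k : SL2 F, k.1 1 0 ≠ 0 → k ∈ H := by
    intro k hk
    have hd := sl2_det k
    have : k = UU ((k.1 0 0 - 1) / k.1 1 0) * LL (k.1 1 0) * UU ((k.1 1 1 - 1) / k.1 1 0) := by
      rw [sl2_ext_iff, sl2_mul_val, sl2_mul_val, m2_ext_iff]
      simp only [m2_mul]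
      simp
      grind
    rw [this]
    exact mul_mem (mul_mem (hU _) (hL _)) (hU _)
  rw [eq_top_iff]
  intro k _
  by_cases hk : k.1 1 0 = 0
  · have : LL 1 * k ∈ H := by
      apply key
      have hd := sl2_det k
      rw [sl2_mul_val, m2_mul]
      simp
      grind
    have h2 := mul_mem (inv_mem (hL 1)) this
    rwa [inv_mul_cancel_left] at h2
  · exact key k hk

theorem borel_solvable : Group.IsSolvable (LStab (E12 : M2 F)) := by
  have h10 : ∀ g : LStab (E12 : M2 F), g.1.1 1 0 = 0 := fun g => mem_LStab_E12.1 g.2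
  let φ : LStab (E12 : M2 F) →* F :=
    { toFun := fun g => g.1.1 0 0
      map_one' := by simp
      map_mul' := fun g h => by
        change (g.1.1 * h.1.1) 0 0 = _
        rw [m2_mul, h10 h]; simp }
  let ψ := φ.toHomUnits
  have hk : ∀ g ∈ ψ.ker, g.1.1 0 0 = 1 ∧ g.1.1 1 1 = 1 := by
    intro g hg
    have h1 : g.1.1 0 0 = 1 := congrArg Units.val (MonoidHom.mem_ker.1 hg)
    have hd := sl2_det g.1
    rw [h1, h10 g] at hd
    refine ⟨h1, by simpa using hd⟩
  have : Group.IsSolvable ψ.ker := by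
    apply Group.isSolvable_of_comm
    rintro ⟨a, ha⟩ ⟨b, hb⟩
    apply Subtype.ext; apply Subtype.ext
    change a.1 * b.1 = b.1 * a.1
    rw [sl2_ext_iff, sl2_mul_val, sl2_mul_val, m2_ext_iff]
    simp only [m2_mul]
    rw [(hk a ha).1, (hk a ha).2, (hk b hb).1, (hk b hb).2, h10 a, h10 b]
    simp [add_comm]
  exact Group.isSolvable_of_ker_le_range ψ.ker.subtype ψ (by simp)

theorem solvable_of_conj_borel (H : Subgroup (SL2 F)) (P : SL2 F)
    (h : ∀ g ∈ H, P * g * P⁻¹ ∈ LStab (E12 : M2 F)) : Group.IsSolvable H := by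
  have := borel_solvable (F := F)
  let f : H →* LStab (E12 : M2 F) :=
    ((MulAut.conj P).toMonoidHom.comp H.subtype).codRestrict _ (fun g => h g.1 g.2)
  refine Group.isSolvable_of_isSolvable_injective (f := f) ?_
  intro a b hab
  have := congrArg Subtype.val hab
  exact Subtype.ext ((MulAut.conj P).injective this)

variable [CharP F 3]

theorem unipotent_of_pgroup (z : SL2 F) (k : ℕ) (hz : z ^ 3 ^ k = 1) :
    z.1.trace = 2 := by
  have h1 : IsNilpotent (z.1 - 1) := by
    refine ⟨3 ^ k, ?_⟩
    have : CharP (M2 F) 3 := inferInstance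
    rw [sub_pow_char_pow_of_commute _ _ (Commute.one_right z.1), one_pow, sub_eq_zero]
    exact congrArg Subtype.val hz
  have := (Matrix.isNilpotent_trace_of_isNilpotent h1).eq_zero
  rw [Matrix.trace_sub] at this
  simp at this
  linear_combination this

theorem full_root_group [Finite F] (hsq : ∀ r : F, r * r ≠ -1)
    (hsub : ∀ (L : AddSubgroup F) (c l : F), c ∈ L → c ≠ 0 → l ≠ 0 → l ≠ 1 → l ≠ -1 →
      (∀ t ∈ L, l * t ∈ L) → L = ⊤)
    (Q : Subgroup (SL2 F)) (hQ : IsPGroup 3 Q) (h x0 : SL2 F)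
    (hn : ∀ x ∈ Q, h * x * h⁻¹ ∈ Q) (hx0 : x0 ∈ Q) (hne : h * x0 * h⁻¹ ≠ x0) :
    ∃ P : SL2 F, ∀ t, P⁻¹ * UU t * P ∈ Q := by
  have : Fact (Nat.Prime 3) := ⟨Nat.prime_three⟩
  have htr : ∀ x ∈ Q, x.1.trace = 2 := by
    intro x hx
    obtain ⟨k, hk⟩ := hQ ⟨x, hx⟩
    exact unipotent_of_pgroup x k (congrArg Subtype.val hk)
  have : Nontrivial Q := by
    refine ⟨⟨x0, hx0⟩, 1, fun h1 => hne ?_⟩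
    have : x0 = 1 := congrArg Subtype.val h1
    rw [this]; simp
  have := hQ.center_nontrivial
  obtain ⟨⟨⟨z, hzQ⟩, hzc⟩, hz1⟩ := exists_ne (1 : Subgroup.center Q)
  have hz1' : z ≠ 1 := by
    rintro rfl; exact hz1 rfl
  have hzc' : ∀ x ∈ Q, x * z = z * x := fun x hx =>
    congrArg Subtype.val (Subgroup.mem_center_iff.1 hzc ⟨x, hx⟩)
  have hdz := sl2_det z
  have htz := htr z hzQ
  obtain ⟨P, c, hc, hP⟩ := exists_conj_E12 (z.1 - 1)
    (by rw [sub_ne_zero]; intro h; exact hz1' ((sl2_ext_iff _ _).2 h))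
    (by rw [Matrix.trace_sub, htz]; simp)
    (by rw [m2_tr] at htz; rw [m2_det]; simp; linear_combination hdz - htz)
  have hz' : P * z * P⁻¹ = UU c := by
    rw [mul_inv_eq_iff_eq_mul, sl2_ext_iff, sl2_mul_val, sl2_mul_val]
    have e : (UU c).1 = 1 + c • E12 := by
      rw [m2_ext_iff]; simp [E12]
    rw [e, add_mul, ← hP]; simp [mul_sub]
  have hQ' : ∀ x ∈ Q, ∃ t, P * x * P⁻¹ = UU t := by
    intro x hx
    have h1 : (P * x * P⁻¹) * UU c = UU c * (P * x * P⁻¹) := by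
      rw [← hz']
      calc _ = P * (x * z) * P⁻¹ := by group
        _ = P * (z * x) * P⁻¹ := by rw [hzc' x hx]
        _ = _ := by group
    have h2 : (P * x * P⁻¹).1.trace = 2 := by rw [tr_conj, htr x hx]
    generalize P * x * P⁻¹ = y at h1 h2
    refine ⟨y.1 0 1, ?_⟩
    rw [sl2_ext_iff, sl2_mul_val, sl2_mul_val, m2_ext_iff] at h1
    simp only [m2_mul] at h1
    simp at h1
    rw [m2_tr] at h2
    rw [sl2_ext_iff, m2_ext_iff]
    simp
    have h3 : y.1 0 0 = y.1 1 1 := by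
      have : c * (y.1 0 0 - y.1 1 1) = 0 := by linear_combination h1.2.1
      simpa [hc, sub_eq_zero] using this
    have h4 : y.1 1 0 = 0 := by grind
    have h20 : (2 : F) ≠ 0 := two_ne_of_three (by exact_mod_cast CharP.cast_eq_zero F 3)
    have h5 : y.1 1 1 = 1 := by
      have : (2 : F) * (y.1 1 1 - 1) = 0 := by linear_combination h2 - h3
      simpa [h20, sub_eq_zero] using this
    exact ⟨h3.trans h5, h4, h5⟩
  refine ⟨P, ?_⟩
  let L : AddSubgroup F :=
    { carrier := {t | P⁻¹ * UU t * P ∈ Q}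
      zero_mem' := by
        change P⁻¹ * UU 0 * P ∈ Q
        rw [(UU_eq_one (0 : F)).2 rfl]; simp
      add_mem' := by
        intro s t hs ht
        change P⁻¹ * UU (s + t) * P ∈ Q
        have hs' : P⁻¹ * UU s * P ∈ Q := hs
        have ht' : P⁻¹ * UU t * P ∈ Q := ht
        have := mul_mem hs' ht'
        have e : P⁻¹ * UU s * P * (P⁻¹ * UU t * P) = P⁻¹ * (UU s * UU t) * P := by group
        rwa [e, UU_mul] at this
      neg_mem' := by
        intro t ht
        change P⁻¹ * UU (-t) * P ∈ Q
        have ht' : P⁻¹ * UU t * P ∈ Q := ht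
        have := inv_mem ht'
        have e : (P⁻¹ * UU t * P)⁻¹ = P⁻¹ * (UU t)⁻¹ * P := by group
        rwa [e, UU_inv] at this }
  have mL : ∀ t, t ∈ L ↔ P⁻¹ * UU t * P ∈ Q := fun t => Iff.rfl
  have mL' : ∀ x ∈ Q, ∀ t, P * x * P⁻¹ = UU t → t ∈ L := by
    intro x hx t ht
    rw [mL, ← ht]
    have : P⁻¹ * (P * x * P⁻¹) * P = x := by group
    rwa [this]
  obtain ⟨k, hk⟩ : ∃ k : SL2 F, k = P * h * P⁻¹ := ⟨_, rfl⟩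
  have hkc : ∀ x, P * (h * x * h⁻¹) * P⁻¹ = k * (P * x * P⁻¹) * k⁻¹ := by
    intro x; rw [hk]; group
  have hk10 : k.1 1 0 = 0 := by
    obtain ⟨t, ht⟩ := hQ' _ (hn z hzQ)
    rw [hkc, hz', mul_inv_eq_iff_eq_mul, sl2_ext_iff, sl2_mul_val, sl2_mul_val, m2_ext_iff] at ht
    simp only [m2_mul] at ht
    simp at ht
    grind
  have hdk := sl2_det k
  rw [hk10] at hdk
  have hkU : ∀ t, k * UU t * k⁻¹ = UU (k.1 0 0 * k.1 0 0 * t) := by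
    intro t
    rw [mul_inv_eq_iff_eq_mul, sl2_ext_iff, sl2_mul_val, sl2_mul_val, m2_ext_iff]
    simp only [m2_mul]
    simp [hk10]
    grind
  have := hsub L c (k.1 0 0 * k.1 0 0) (mL' z hzQ c hz') hc ?_ ?_ (hsq _) ?_
  · intro t
    rw [← mL, this]; trivial
  · intro h0
    have : k.1 0 0 = 0 := by simpa using h0
    rw [this] at hdk; simp at hdk
  · intro h1
    obtain ⟨t, ht⟩ := hQ' x0 hx0
    apply hne
    have h2 := hkc x0
    rw [ht, hkU, h1, one_mul, ← ht] at h2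
    simpa using h2
  · intro t ht
    rw [mL] at ht
    have h1 := hn _ ht
    refine mL' _ h1 _ ?_
    rw [hkc, ← hkU]
    congr 2; group
  
end borel

section psl
variable {F : Type*} [Field F]

theorem mem_center_isPM {g : SL2 F} : g ∈ Subgroup.center (SL2 F) ↔ IsPM g := by
  constructor
  · intro h
    obtain ⟨r, _, hr⟩ := Matrix.SpecialLinearGroup.mem_center_iff.1 h
    exact isPM_of_scalar g r (by rw [← hr, Matrix.smul_one_eq_diagonal]; rfl)
  · intro h
    rw [Subgroup.mem_center_iff]
    intro k
    exact (h.comm k).symm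

theorem centralizer_cyclic_aux (K : Type*) [Field K] [Algebra F K] [IsAlgClosed K] [Finite F] (h2 : (2 : F) ≠ 0) (z : SL2 F) (hz : ¬ IsPM z)
    (ht : z.1.trace * z.1.trace ≠ 4) : IsCyclic (Subgroup.centralizer {z}) := by
  have hns := nonscalar_of_not_isPM hz
  have hex : ∀ g : Subgroup.centralizer {z}, ∃ α β : F, g.1.1 = α • 1 + β • z.1 := by
    rintro ⟨g, hg⟩
    have : z * g = g * z := Subgroup.mem_centralizer_singleton_iff.1 hg |>.symm
    exact commutant z.1 g.1 (congrArg Subtype.val this) hns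
  choose α β hab using hex
  have huniq : ∀ a b a' b' : F, a • 1 + b • z.1 = a' • 1 + b' • z.1 → a = a' ∧ b = b' := by
    intro a b a' b' h
    have hb : b = b' := by
      by_contra hb
      have hb' : b - b' ≠ 0 := sub_ne_zero.2 hb
      apply hns ((b - b')⁻¹ * (a' - a))
      have : (b - b') • z.1 = (a' - a) • 1 := by
        rw [sub_smul, sub_smul, sub_eq_sub_iff_add_eq_add, add_comm, h, add_comm]
      rw [mul_smul, ← this, smul_smul, inv_mul_cancel₀ hb', one_smul]
    subst hb
    refine ⟨?_, rfl⟩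
    have h3 := add_right_cancel h
    have := congrFun (congrFun h3 0) 0
    simpa using this
  obtain ⟨s, hs⟩ := IsAlgClosed.exists_eq_mul_self
    (algebraMap F K (z.1.trace * z.1.trace - 4))
  set t := z.1.trace with htdef
  let ι := algebraMap F K
  have h2K : (2 : K) ≠ 0 := by
    have := (map_ne_zero ι).2 h2
    rwa [map_ofNat] at this
  obtain ⟨θ, hθ⟩ : ∃ θ : K, θ = (ι t + s) / 2 := ⟨_, rfl⟩
  have hθ2 : θ * θ = ι t * θ - 1 := by
    rw [hθ]; simp only [map_sub, map_mul, map_ofNat] at hs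
    field_simp
    linear_combination -hs
  have hθne : θ ≠ ι t - θ := by
    intro h
    apply ht
    have hs0 : s = 0 := by
      rw [hθ] at h
      have : s = 2 * ((ι t + s)/2) - ι t := by field_simp; ring
      rw [this]; linear_combination h
    rw [hs0, mul_zero] at hs
    have := (map_eq_zero (algebraMap F K)).1 hs
    linear_combination this
  have hzz : z.1 * z.1 = t • z.1 - 1 := by
    have hd := sl2_det z
    rw [htdef, m2_tr, m2_ext_iff]
    simp only [m2_mul]
    simp
    refine ⟨by linear_combination -hd, by ring, by ring, by linear_combination -hd⟩
  have hαβ1 : α 1 = 1 ∧ β 1 = 0 := by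
    apply huniq; rw [← hab]; simp
  have hmul : ∀ g h, α (g * h) = α g * α h - β g * β h ∧
      β (g * h) = α g * β h + β g * α h + t * (β g * β h) := by
    intro g h
    apply huniq
    rw [← hab]
    change g.1.1 * h.1.1 = _
    rw [hab g, hab h, add_mul, mul_add, mul_add, smul_mul_smul_comm, smul_mul_smul_comm,
      smul_mul_smul_comm, smul_mul_smul_comm, hzz]
    simp only [one_mul, mul_one]
    module
  let φ : Subgroup.centralizer {z} →* K :=
    { toFun := fun g => ι (α g) + ι (β g) * θ
      map_one' := by rw [hαβ1.1, hαβ1.2]; simp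
      map_mul' := fun g h => by
        rw [(hmul g h).1, (hmul g h).2]
        simp only [map_sub, map_mul, map_add]
        linear_combination - ι (β g) * ι (β h) * hθ2 }
  refine isCyclic_of_injective_ringHom (f := φ) ?_
  rw [injective_iff_map_eq_one]
  intro g hg
  have hg' : ι (α g) + ι (β g) * θ = 1 := hg
  have hdet : α g * α g + α g * β g * t + β g * β g = 1 := by
    have h1 := sl2_det g.1
    have hd := sl2_det z
    rw [hab g] at h1
    simp at h1
    rw [htdef, m2_tr]
    linear_combination h1 - β g * β g * hd
  have hdK : ι (α g) * ι (α g) + ι (α g) * ι (β g) * ι t + ι (β g) * ι (β g) = 1 := by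
    have := congrArg ι hdet
    simpa using this
  have h1 : ι (α g) + ι (β g) * (ι t - θ) = 1 := by
    have : (ι (α g) + ι (β g) * θ) * (ι (α g) + ι (β g) * (ι t - θ)) = 1 := by
      rw [← hdK]; linear_combination - ι (β g) * ι (β g) * hθ2
    rwa [hg', one_mul] at this
  have hb : ι (β g) = 0 := by
    have : ι (β g) * (θ - (ι t - θ)) = 0 := by linear_combination hg' - h1
    rcases mul_eq_zero.1 this with h | h
    · exact h
    · exact absurd (sub_eq_zero.1 h) hθne
  have ha : ι (α g) = 1 := by rw [hb] at hg'; simpa using hg'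
  have hb' : β g = 0 := (map_eq_zero ι).1 hb
  have ha' : α g = 1 := ι.injective (by rw [ha, map_one])
  apply Subtype.ext
  rw [sl2_ext_iff, hab g, ha', hb']
  simp

theorem centralizer_cyclic [Finite F] (h2 : (2 : F) ≠ 0) (z : SL2 F) (hz : ¬ IsPM z)
    (ht : z.1.trace * z.1.trace ≠ 4) : IsCyclic (Subgroup.centralizer {z}) :=
  centralizer_cyclic_aux (AlgebraicClosure F) h2 z hz ht

/-- The projective special linear group as a quotient. -/
abbrev PS (F : Type*) [Field F] := SL2 F ⧸ Subgroup.center (SL2 F)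

theorem cyclic_pgroup [Finite F] [CharP F 3] {R : Type*} [Group R] [Finite R] (r : ℕ)
    (hr : r.Prime) (hr2 : r ≠ 2) (hr3 : r ≠ 3) (hR : IsPGroup r R) (f : R →* PS F)
    (hf : Function.Injective f) : IsCyclic R := by
  have : Fact r.Prime := ⟨hr⟩
  have h3 : (3 : F) = 0 := by exact_mod_cast CharP.cast_eq_zero F 3
  have h2 := two_ne_of_three h3
  rcases subsingleton_or_nontrivial R with hs | hs
  · infer_instance
  have := hR.center_nontrivial
  obtain ⟨⟨z, hzc⟩, hz1⟩ := exists_ne (1 : Subgroup.center R)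
  have hz1' : z ≠ 1 := by rintro rfl; exact hz1 rfl
  rw [Subgroup.mem_center_iff] at hzc
  have hnt : ∀ k : ℕ, k.Prime → k ≠ r → z ^ k ≠ 1 := by
    intro k hk hkr hzk
    obtain ⟨j, hj⟩ := hR z
    have h1 := orderOf_dvd_of_pow_eq_one hzk
    have h2 := orderOf_dvd_of_pow_eq_one hj
    have h3 : Nat.Coprime k (r ^ j) := Nat.Coprime.pow_right _ ((Nat.coprime_primes hk hr).2 hkr)
    have := Nat.eq_one_of_dvd_coprimes h3 h1 h2
    exact hz1' (orderOf_eq_one_iff.1 this)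
  obtain ⟨w, hw⟩ := QuotientGroup.mk_surjective (f z)
  have hpow : ∀ k : ℕ, IsPM (w ^ k) → z ^ k = 1 := by
    intro k hk
    apply hf
    rw [map_pow, ← hw, map_one, ← QuotientGroup.mk_pow, QuotientGroup.eq_one_iff]
    exact mem_center_isPM.2 hk
  have hwpm : ¬ IsPM w := fun h => hz1' (by simpa using hpow 1 (by simpa using h))
  have hwt : w.1.trace ≠ 0 := by
    intro h
    refine hnt 2 Nat.prime_two hr2.symm (hpow 2 ?_)
    rw [sq, sq_of_tr_zero h]; exact Or.inr rfl
  have hw4 : w.1.trace * w.1.trace ≠ 4 := by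
    intro h
    refine hnt 3 Nat.prime_three hr3.symm (hpow 3 ?_)
    have hd := sl2_det w
    have key : ∀ w : SL2 F, w.1.trace = 2 → w ^ 3 = 1 := by
      intro w h
      have hd := sl2_det w
      rw [m2_tr] at h
      rw [pow_succ, sq, sl2_ext_iff, sl2_mul_val, sl2_mul_val, m2_ext_iff]
      simp only [m2_mul]
      simp
      have e : w.1 1 1 = 2 - w.1 0 0 := by linear_combination h
      rw [e] at hd ⊢
      grind
    have : (w.1.trace - 2) * (w.1.trace + 2) = 0 := by linear_combination h
    rcases mul_eq_zero.1 this with h | h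
    · exact Or.inl (key w (sub_eq_zero.1 h))
    · right
      have := key (-w) (by rw [tr_neg]; linear_combination -h)
      rw [Odd.neg_pow (by decide)] at this
      rw [← this, neg_neg]
  have hcyc := centralizer_cyclic h2 w hwpm hw4
  let C : Subgroup (PS F) := (Subgroup.centralizer {w}).map (QuotientGroup.mk' _)
  have hC : IsCyclic C := isCyclic_of_surjective
    ((QuotientGroup.mk' (Subgroup.center (SL2 F))).subgroupMap (Subgroup.centralizer {w}))
    (MonoidHom.subgroupMap_surjective _ _)
  have hm : ∀ x, f x ∈ C := by
    intro x
    obtain ⟨g, hg⟩ := QuotientGroup.mk_surjective (f x)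
    refine ⟨g, ?_, hg⟩
    have h1 : f x * f z = f z * f x := by rw [← map_mul, hzc x, map_mul]
    rw [← hg, ← hw, ← QuotientGroup.mk_mul, ← QuotientGroup.mk_mul, QuotientGroup.eq,
      mem_center_isPM] at h1
    have h1' : PMEq (w * g) (g * w) := by
      rcases h1 with h | h
      · left; rw [inv_mul_eq_one] at h; exact h.symm
      · right; rw [inv_mul_eq_iff_eq_mul] at h; simp [h]
    rcases h1' with h | h
    · exact Subgroup.mem_centralizer_singleton_iff.2 h.symm
    · exact absurd (anti_tr h2 h) hwt
  exact isCyclic_of_injective (f.codRestrict C hm) (fun a b h => hf (congrArg Subtype.val h))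

end psl

section proper
variable {F : Type*} [Field F] [Finite F] [CharP F 3]

theorem card_PS : Nat.card (SL2 F) = Nat.card (PS F) * 2 := by
  have h3 : (3 : F) = 0 := by exact_mod_cast CharP.cast_eq_zero F 3
  have h2 := two_ne_of_three h3
  rw [Subgroup.card_eq_card_quotient_mul_card_subgroup (Subgroup.center (SL2 F))]
  congr 1
  have : (Subgroup.center (SL2 F) : Set (SL2 F)) = {1, -1} := by
    ext g
    simp only [SetLike.mem_coe, mem_center_isPM]
    rfl
  change Nat.card ((Subgroup.center (SL2 F) : Set (SL2 F)) : Type _) = 2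
  rw [this, Nat.card_coe_set_eq, Set.ncard_pair]
  intro h
  have := congrArg (fun g : SL2 F => g.1 0 0) h
  simp at this
  apply h2
  linear_combination this

theorem solvable_of_pgroup {G : Type*} [Group G] [Finite G] {p : ℕ} (hp : p.Prime)
    (h : IsPGroup p G) : Group.IsSolvable G := by
  have : Fact p.Prime := ⟨hp⟩
  have := h.isNilpotent
  infer_instance

theorem comm_of_card_dvd_four {P : Type*} [Group P] [Finite P] (h : Nat.card P ∣ 4) (a b : P) :
    a * b = b * a := by
  have : Fact (Nat.Prime 2) := ⟨Nat.prime_two⟩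
  have h' : Nat.card P ∈ Nat.divisors (2 ^ 2) := by simpa using h
  rw [Nat.divisors_prime_pow Nat.prime_two] at h'
  simp at h'
  obtain ⟨k, hk, hc⟩ := h'
  interval_cases k
  · have : Subsingleton P := (Nat.card_eq_one_iff_unique.1 (by simpa using hc.symm)).1
    exact Subsingleton.elim _ _
  · have : IsCyclic P := isCyclic_of_prime_card (p := 2) (by simpa using hc.symm)
    have := IsCyclic.isMulCommutative (α := P)
    exact this.is_comm.comm a b
  · have := IsPGroup.isMulCommutative_of_card_eq_prime_sq (p := 2) (G := P) hc.symm
    exact this.is_comm.comm a b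

theorem solvable_prime_to_three_PS (h16 : ¬ 16 ∣ Nat.card (SL2 F)) {K : Type*} [Group K] [Finite K]
    (h3K : ¬ 3 ∣ Nat.card K) (f : K →* PS F) (hf : Function.Injective f) : Group.IsSolvable K := by
  have : Fact (Nat.Prime 2) := ⟨Nat.prime_two⟩
  have h8 : ¬ 8 ∣ Nat.card K := by
    intro h
    apply h16
    rw [card_PS]
    have := h.trans (Subgroup.card_dvd_of_injective f hf)
    obtain ⟨c, hc⟩ := this
    exact ⟨c, by rw [hc]; ring⟩
  let P : Sylow 2 K := default
  have hP4 : Nat.card P ∣ 4 := by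
    obtain ⟨n, hn⟩ := IsPGroup.iff_card.1 P.2
    have h1 : (2 ^ n : ℕ) ∣ Nat.card K := hn ▸ Subgroup.card_subgroup_dvd_card (P : Subgroup K)
    have h2 : n ≤ 2 := by
      by_contra hc
      exact h8 ((pow_dvd_pow 2 (show 3 ≤ n by omega)).trans h1)
    change Nat.card (P : Subgroup K) ∣ 4
    rw [hn]
    exact pow_dvd_pow 2 h2
  have hcomm := comm_of_card_dvd_four hP4
  have hNC : Subgroup.normalizer (P : Set K) ≤ Subgroup.centralizer (P : Set K) := by
    let φ := (P : Subgroup K).normalizerMonoidHom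
    have hle : (P : Subgroup K).subgroupOf (Subgroup.normalizer (P : Set K)) ≤ φ.ker := by
      rw [Subgroup.normalizerMonoidHom_ker]
      intro x hx
      rw [Subgroup.mem_subgroupOf] at hx ⊢
      rw [Subgroup.mem_centralizer_iff]
      intro y hy
      exact congrArg Subtype.val (hcomm ⟨y, hy⟩ ⟨x.1, hx⟩)
    have hidx : φ.ker.index ∣ (P : Subgroup K).index :=
      (Subgroup.index_dvd_of_le hle).trans
        (Subgroup.relIndex_dvd_index_of_le Subgroup.le_normalizer)
    have hodd : ¬ 2 ∣ φ.ker.index := fun h => P.not_dvd_index (h.trans hidx)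
    have hn3 : ¬ 3 ∣ φ.ker.index := fun h => h3K
      (h.trans (hidx.trans (Subgroup.index_dvd_card _)))
    have h24 : φ.ker.index ∣ 24 := by
      rw [Subgroup.index_ker]
      refine (Subgroup.card_subgroup_dvd_card _).trans ?_
      have h1 : Nat.card (MulAut P) ∣ Nat.card (Equiv.Perm P) :=
        Subgroup.card_dvd_of_injective (MulAut.toPerm P) (by
          intro a b h
          ext x
          exact congrArg Subtype.val (DFunLike.congr_fun h x))
      refine h1.trans ?_
      rw [Nat.card_perm]
      have : Nat.card P ≤ 4 := Nat.le_of_dvd (by norm_num) hP4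
      exact Nat.factorial_dvd_factorial this
    have h1 : φ.ker.index = 1 := by
      have hc2 : Nat.Coprime (φ.ker.index) (2 ^ 3) :=
        (((Nat.Prime.coprime_iff_not_dvd Nat.prime_two).2 hodd).symm).pow_right 3
      have hc3 : Nat.Coprime (φ.ker.index) 3 :=
        ((Nat.Prime.coprime_iff_not_dvd Nat.prime_three).2 hn3).symm
      have := Nat.Coprime.mul_right hc2 hc3
      exact Nat.eq_one_of_dvd_coprimes this dvd_rfl h24
    have htop := Subgroup.index_eq_one.1 h1
    intro x hx
    have : (⟨x, hx⟩ : Subgroup.normalizer (P : Set K)) ∈ φ.ker := by rw [htop]; trivial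
    rw [Subgroup.normalizerMonoidHom_ker] at this
    exact this
  let τ := MonoidHom.transferSylow P hNC
  have hτ : ¬ 2 ∣ Nat.card τ.ker := MonoidHom.not_dvd_card_ker_transferSylow P hNC
  have hZ : IsZGroup τ.ker := by
    refine ⟨fun r hr R => ?_⟩
    by_cases hr2 : r = 2
    · subst hr2
      have : Nat.card R = 1 := by
        obtain ⟨n, hn⟩ := IsPGroup.iff_card.1 R.2
        have h1 : (2 ^ n : ℕ) ∣ Nat.card τ.ker :=
          hn ▸ Subgroup.card_subgroup_dvd_card (R : Subgroup τ.ker)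
        rcases Nat.eq_zero_or_pos n with h | h
        · subst h; simpa using hn
        · exact absurd ((dvd_pow_self 2 h.ne').trans h1) hτ
      have : Subsingleton R := (Nat.card_eq_one_iff_unique.1 this).1
      infer_instance
    by_cases hr3 : r = 3
    · subst hr3
      have : Nat.card R = 1 := by
        have : Fact (Nat.Prime 3) := ⟨hr⟩
        obtain ⟨n, hn⟩ := IsPGroup.iff_card.1 R.2
        have h1 : (3 ^ n : ℕ) ∣ Nat.card τ.ker :=
          hn ▸ Subgroup.card_subgroup_dvd_card (R : Subgroup τ.ker)
        rcases Nat.eq_zero_or_pos n with h | h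
        · subst h; simpa using hn
        · exact absurd (((dvd_pow_self 3 h.ne').trans h1).trans
            (Subgroup.card_subgroup_dvd_card τ.ker)) h3K
      have : Subsingleton R := (Nat.card_eq_one_iff_unique.1 this).1
      infer_instance
    exact cyclic_pgroup r hr hr2 hr3 R.2 ((f.comp τ.ker.subtype).comp (R : Subgroup τ.ker).subtype)
      (by
        intro a b h
        exact Subtype.ext (Subtype.ext (hf h)))
  have : Group.IsSolvable τ.ker := inferInstance
  have : Group.IsSolvable P := solvable_of_pgroup Nat.prime_two P.2
  exact Group.isSolvable_of_ker_le_range τ.ker.subtype τ (by simp)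

theorem solvable_of_central_ker {G H : Type*} [Group G] [Group H] (f : G →* H)
    (hf : f.ker ≤ Subgroup.center G) [Group.IsSolvable f.range] : Group.IsSolvable G := by
  have : Group.IsSolvable f.ker := by
    apply Group.isSolvable_of_comm
    intro a b
    exact Subtype.ext ((Subgroup.mem_center_iff.1 (hf a.2) b.1).symm)
  refine Group.isSolvable_of_ker_le_range f.ker.subtype f.rangeRestrict ?_
  intro x hx
  rw [MonoidHom.ker_rangeRestrict] at hx
  simpa using hx

theorem solvable_prime_to_three (h16 : ¬ 16 ∣ Nat.card (SL2 F)) {K : Type*} [Group K] [Finite K]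
    (h3K : ¬ 3 ∣ Nat.card K) (f : K →* SL2 F) (hf : Function.Injective f) : Group.IsSolvable K := by
  let g : K →* PS F := (QuotientGroup.mk' _).comp f
  have : Group.IsSolvable g.range := by
    refine solvable_prime_to_three_PS h16 ?_ g.range.subtype Subtype.val_injective
    intro h
    exact h3K (h.trans (Subgroup.card_range_dvd g))
  refine solvable_of_central_ker g ?_
  intro x hx
  have hx' : f x ∈ Subgroup.center (SL2 F) := by
    rw [MonoidHom.mem_ker] at hx
    exact (QuotientGroup.eq_one_iff _).1 hx
  rw [Subgroup.mem_center_iff] at hx' ⊢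
  intro y
  apply hf
  rw [map_mul, map_mul, hx']

theorem solvable_of_proper (hsq : ∀ r : F, r * r ≠ -1)
    (hsub : ∀ (L : AddSubgroup F) (c l : F), c ∈ L → c ≠ 0 → l ≠ 0 → l ≠ 1 → l ≠ -1 →
      (∀ t ∈ L, l * t ∈ L) → L = ⊤)
    (h16 : ¬ 16 ∣ Nat.card (SL2 F)) (H : Subgroup (SL2 F)) (hH : H ≠ ⊤) : Group.IsSolvable H := by
  have : Fact (Nat.Prime 3) := ⟨Nat.prime_three⟩
  let Q : Sylow 3 H := default
  by_cases hNC : Subgroup.normalizer (Q : Set H) ≤ Subgroup.centralizer (Q : Set H)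
  · let τ := MonoidHom.transferSylow Q hNC
    have hτ : ¬ 3 ∣ Nat.card τ.ker := MonoidHom.not_dvd_card_ker_transferSylow Q hNC
    have : Group.IsSolvable τ.ker := solvable_prime_to_three h16 hτ (H.subtype.comp τ.ker.subtype)
      (fun a b h => Subtype.ext (Subtype.ext h))
    have : Group.IsSolvable Q := solvable_of_pgroup Nat.prime_three Q.2
    exact Group.isSolvable_of_ker_le_range τ.ker.subtype τ (by simp)
  · rw [SetLike.not_le_iff_exists] at hNC
    obtain ⟨h, hN, hC⟩ := hNC
    rw [Subgroup.mem_centralizer_iff] at hC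
    push Not at hC
    obtain ⟨x0, hx0, hne⟩ := hC
    obtain ⟨P, hP⟩ := full_root_group hsq hsub ((Q : Subgroup H).map H.subtype)
      (Q.2.map _) h.1 x0.1 (by
        rintro _ ⟨x, hx, rfl⟩
        exact ⟨h * x * h⁻¹, (Subgroup.mem_set_normalizer_iff.1 hN x).1 hx, rfl⟩)
      ⟨x0, hx0, rfl⟩ (by
        intro he
        apply hne
        have : h * x0 * h⁻¹ = x0 := Subtype.ext he
        rw [mul_inv_eq_iff_eq_mul] at this
        exact this.symm)
    have hPH : ∀ t, P⁻¹ * UU t * P ∈ H := by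
      intro t
      obtain ⟨x, _, hx⟩ := hP t
      rw [← hx]; exact x.2
    by_cases hB : ∀ g ∈ H, P * g * P⁻¹ ∈ LStab (E12 : M2 F)
    · exact solvable_of_conj_borel H P hB
    · exfalso
      push Not at hB
      obtain ⟨g, hg, hgn⟩ := hB
      rw [mem_LStab_E12] at hgn
      apply hH
      have htop := gen_top (H.map (MulAut.conj P).toMonoidHom) (by
        intro t
        refine ⟨_, hPH t, ?_⟩
        simp [MulAut.conj_apply, mul_assoc]) (P * g * P⁻¹) ⟨g, hg, rfl⟩ hgn
      rw [eq_top_iff]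
      intro k _
      have : P * k * P⁻¹ ∈ H.map (MulAut.conj P).toMonoidHom := by rw [htop]; trivial
      obtain ⟨k', hk', he⟩ := this
      have := (MulAut.conj P).injective he
      rwa [← this]

end proper

section lines
variable {F : Type*} [Field F]

/-- Two elements generate a solvable subgroup. -/
def Solv (g h : SL2 F) : Prop := Group.IsSolvable (Subgroup.closure {g, h})

theorem Solv_of_mem {g h : SL2 F} (H : Subgroup (SL2 F)) (hH : Group.IsSolvable H) (hg : g ∈ H)
    (hh : h ∈ H) : Solv g h := by
  have hle : Subgroup.closure {g, h} ≤ H := by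
    rw [Subgroup.closure_le]
    rintro z (rfl | rfl)
    · exact hg
    · exact hh
  exact Group.isSolvable_of_isSolvable_injective (f := Subgroup.inclusion hle)
    (Subgroup.inclusion_injective hle)

theorem common_line (h3 : (3 : F) = 0) (hsq : ∀ r : F, r * r ≠ -1) {m y : SL2 F} (hs : Solv m y)
    (hm0 : m.1.trace ≠ 0) (hm1 : m.1.trace * m.1.trace ≠ 1) :
    ∃ n : M2 F, n ≠ 0 ∧ n.trace = 0 ∧ m ∈ LStab n ∧ y ∈ LStab n := by
  have h2 := two_ne_of_three h3
  rcases structure_thm h2 _ hs with ⟨n, hn, ht, hle⟩ | ⟨a, b, hF, hle⟩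
  · exact ⟨n, hn, ht, hle (Subgroup.subset_closure (by simp)),
      hle (Subgroup.subset_closure (by simp))⟩
  · exfalso
    have hm : m ∈ FStab a b := hle (Subgroup.subset_closure (by simp))
    rcases frame_tr h3 hsq hF hm with h | h
    · exact hm1 h
    · exact hm0 (Fr_tr h2 hF h)

theorem line_conj (P : SL2 F) (n : M2 F) : P.1 * n = (P.1 * n * (P⁻¹).1) * P.1 ∧
    (P.1 * n * (P⁻¹).1).trace = n.trace ∧ (n ≠ 0 → P.1 * n * (P⁻¹).1 ≠ 0) ∧
    (P.1 * n * (P⁻¹).1).det = n.det := by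
  have h1 : P.1 * (P⁻¹).1 = 1 := congrArg Subtype.val (mul_inv_cancel P)
  have h2 : (P⁻¹).1 * P.1 = 1 := congrArg Subtype.val (inv_mul_cancel P)
  refine ⟨by rw [mul_assoc _ _ P.1, h2, mul_one], ?_, ?_, ?_⟩
  · rw [Matrix.trace_mul_comm, ← mul_assoc, h2, one_mul]
  · intro hn h
    apply hn
    have : (P⁻¹).1 * (P.1 * n * (P⁻¹).1) * P.1 = n := by
      rw [mul_assoc, mul_assoc _ _ P.1, h2, mul_one, ← mul_assoc, h2, one_mul]
    rw [← this, h]; simp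
  · rw [Matrix.det_mul, Matrix.det_mul, P.2, (P⁻¹).2]; simp

/-- The diagonal element with entries `a`, `a⁻¹`. -/
def DD (a : F) (ha : a ≠ 0) : SL2 F := ⟨!![a, 0; 0, a⁻¹], by simp [m2_det, ha]⟩

theorem DD_line (h2 : (2 : F) ≠ 0) {a : F} (ha : a ≠ 0) (ha4 : a * a * (a * a) ≠ 1) {n : M2 F}
    (hn : n ≠ 0)
    (ht : n.trace = 0) (h : DD a ha ∈ LStab n) {y : SL2 F} (hy : y ∈ LStab n) (hy00 : y.1 0 0 ≠ 0)
    (hy01 : y.1 0 1 ≠ 0) (hy10 : y.1 1 0 ≠ 0) : False := by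
  obtain ⟨l, hl⟩ := h
  obtain ⟨k, hk⟩ := hy
  rw [m2_tr] at ht
  have h11 : n 1 1 = - n 0 0 := by linear_combination ht
  simp only [m2_ext_iff, m2_mul, Matrix.smul_apply] at hl hk
  simp [DD, h11] at hl
  simp [h11] at hk
  have hn' : ¬ (n 0 0 = 0 ∧ n 0 1 = 0 ∧ n 1 0 = 0) := by
    intro h
    apply hn
    rw [m2_ext_iff]
    simp [h11, h]
  obtain ⟨l1, l2, l3, l4⟩ := hl
  obtain ⟨k1, k2, k3, k4⟩ := hk
  have haa : a * a ≠ 1 := by intro h; apply ha4; rw [h]; ring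
  by_cases hu : n 0 0 = 0
  · by_cases hv : n 0 1 = 0
    · have hw : n 1 0 ≠ 0 := fun hw => hn' ⟨hu, hv, hw⟩
      rw [hu, hv] at k1
      simp [hy01, hw] at k1
    · by_cases hw : n 1 0 = 0
      · rw [hu, hw] at k1
        simp at k1
        rw [hu, hw] at k4
        simp at k4
        grind
      · have e1 : l = a * a := by
          field_simp at l2
          linear_combination -l2
        have e2 : l * (a * a) = 1 := by
          field_simp at l3
          linear_combination -l3
        apply ha4; rw [← e2, e1]
  · have e1 : l = 1 := by
      have : (a * n 0 0) * (l - 1) = 0 := by linear_combination -l1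
      rcases mul_eq_zero.1 this with h | h
      · simp [ha, hu] at h
      · exact sub_eq_zero.1 h
    subst e1
    have hv : n 0 1 = 0 := by
      have : n 0 1 * (a * a - 1) = 0 := by
        field_simp at l2
        linear_combination l2
      rcases mul_eq_zero.1 this with h | h
      · exact h
      · exact absurd (sub_eq_zero.1 h) haa
    have hw : n 1 0 = 0 := by
      have : n 1 0 * (a * a - 1) = 0 := by
        field_simp at l3
        linear_combination -l3
      rcases mul_eq_zero.1 this with h | h
      · exact h
      · exact absurd (sub_eq_zero.1 h) haa
    simp [hv, hw] at k1 k2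
    have e1 : k = 1 := by
      have : (n 0 0 * y.1 0 0) * (k - 1) = 0 := by linear_combination -k1
      rcases mul_eq_zero.1 this with h | h
      · simp [hy00, hu] at h
      · exact sub_eq_zero.1 h
    subst e1
    have : 2 * (n 0 0 * y.1 0 1) = 0 := by linear_combination -k2
    simp [h2, hu, hy01] at this

theorem UU_line (h2 : (2 : F) ≠ 0) {r : F} (hr : r ≠ 0) {n : M2 F} (ht : n.trace = 0)
    (h : UU r ∈ LStab n) : n 0 0 = 0 ∧ n 1 0 = 0 ∧ n 1 1 = 0 := by
  obtain ⟨l, hl⟩ := h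
  rw [m2_tr] at ht
  have h11 : n 1 1 = - n 0 0 := by linear_combination ht
  simp only [m2_ext_iff, m2_mul, Matrix.smul_apply] at hl
  simp [h11] at hl
  obtain ⟨l1, l2, l3, l4⟩ := hl
  have hw : n 1 0 = 0 := by
    by_contra hw
    have e : l = 1 := by grind
    subst e
    have : r * n 1 0 = 0 := by linear_combination l1
    simp [hr, hw] at this
  rw [hw] at l1 l4
  have hu : n 0 0 = 0 := by
    by_contra hu
    have e : l = 1 := by grind
    subst e
    have : 2 * (r * n 0 0) = 0 := by linear_combination -l2
    simp [h2, hr, hu] at this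
  exact ⟨hu, hw, by rw [h11, hu, neg_zero]⟩

theorem LStab_ne_top (h2 : (2 : F) ≠ 0) {n : M2 F} (hn : n ≠ 0) (ht : n.trace = 0) :
    LStab n ≠ ⊤ := by
  intro h
  obtain ⟨h00, h10, h11⟩ := UU_line h2 one_ne_zero ht (by rw [h]; trivial : UU 1 ∈ LStab n)
  have : LL 1 ∈ LStab n := by rw [h]; trivial
  obtain ⟨l, hl⟩ := this
  simp only [m2_ext_iff, m2_mul, Matrix.smul_apply] at hl
  simp [h00, h10, h11] at hl
  apply hn
  rw [m2_ext_iff]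
  simp [h00, h10, h11]
  grind

theorem FStab_ne_top (h3 : (3 : F) = 0) (hsq : ∀ r : F, r * r ≠ -1) {c : F} (hc0 : c ≠ 0)
    (hc1 : c * c ≠ 1) {a b : SL2 F} (hF : IsFrame a b) : FStab a b ≠ ⊤ := by
  intro h
  have h2 := two_ne_of_three h3
  let g : SL2 F := ⟨!![c, -1; 1, 0], by simp [m2_det]⟩
  have hg : g.1.trace = c := by rw [m2_tr]; simp [g]
  rcases frame_tr h3 hsq hF (by rw [h]; trivial : g ∈ FStab a b) with h | h
  · rw [hg] at h; exact hc1 h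
  · have := Fr_tr h2 hF h
    rw [hg] at this; exact hc0 this

open Polynomial in
theorem exists_shift [Finite F] (hcard : 4 ≤ Nat.card F) (p q r : F) (c : F) (hc : c ≠ 0) :
    ∃ s : F, p - s * c ≠ 0 ∧ q + s * (p - r) - s * s * c ≠ 0 := by
  have := Fintype.ofFinite F
  let f : F[X] := (C p - X * C c) * (C q + X * C (p - r) - X * X * C c)
  have hf1 : (C p - X * C c) ≠ 0 := by
    intro h
    have := congrArg (fun f => coeff f 1) h
    simp [coeff_C] at this
    exact hc this
  have hf2 : (C q + X * C (p - r) - X * X * C c) ≠ 0 := by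
    intro h
    have := congrArg (fun f => coeff f 2) h
    simp only [coeff_sub, coeff_add, coeff_mul_C, coeff_C, coeff_X] at this
    rw [← sq, coeff_X_pow] at this
    simp at this
    exact hc this
  have hdeg : f.natDegree ≤ 3 := by
    simp only [f]; compute_degree
  obtain ⟨s, hs⟩ := Polynomial.exists_eval_ne_zero_of_natDegree_lt_card f (mul_ne_zero hf1 hf2) (by
    rw [Cardinal.mk_fintype]
    rw [Nat.card_eq_fintype_card] at hcard
    exact_mod_cast (by omega : f.natDegree < Fintype.card F))
  rw [eval_mul] at hs
  refine ⟨s, ?_, ?_⟩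
  · have := left_ne_zero_of_mul hs
    rwa [eval_sub, eval_C, eval_mul, eval_C, eval_X] at this
  · have := right_ne_zero_of_mul hs
    simpa using this

theorem nil_line (h3 : (3 : F) = 0) (hsq : ∀ r : F, r * r ≠ -1) [Finite F]
    (hcard : 4 ≤ Nat.card F) {a : F} (ha : a ≠ 0) (ha1 : a * a ≠ 1) {n : M2 F} (hn : n ≠ 0)
    (ht : n.trace = 0) (hd : n.det = 0) (y : SL2 F) (H : ∀ m ∈ LStab n, Solv m y) :
    y ∈ LStab n := by
  have h2 := two_ne_of_three h3
  obtain ⟨P, c, hc, hP⟩ := exists_conj_E12 n hn ht hd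
  have hPn : ∀ g, g ∈ LStab n ↔ P * g * P⁻¹ ∈ LStab (E12 : M2 F) := by
    intro g
    rw [LStab_conj hP, LStab_smul hc]
  rw [hPn, mem_LStab_E12]
  by_contra h10
  obtain ⟨y1, hy1⟩ : ∃ y1, y1 = P * y * P⁻¹ := ⟨_, rfl⟩
  rw [← hy1] at h10
  obtain ⟨s, hs1, hs2⟩ := exists_shift hcard (y1.1 0 0) (y1.1 0 1) (y1.1 1 1) _ h10
  have hUB : ∀ t : F, UU t ∈ LStab (E12 : M2 F) := fun t => mem_LStab_E12.2 (by simp)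
  have hDB : DD a ha ∈ LStab (E12 : M2 F) := mem_LStab_E12.2 (by simp [DD])
  obtain ⟨R, hR⟩ : ∃ R : SL2 F, R = UU (-s) * P := ⟨_, rfl⟩
  have hm : R⁻¹ * DD a ha * R ∈ LStab n := by
    rw [hPn]
    have : P * (R⁻¹ * DD a ha * R) * P⁻¹ = (UU (-s))⁻¹ * DD a ha * UU (-s) := by
      rw [hR]; group
    rw [this]
    exact mul_mem (mul_mem (inv_mem (hUB _)) hDB) (hUB _)
  have htm : (R⁻¹ * DD a ha * R).1.trace = a + a⁻¹ := by
    have := tr_conj R⁻¹ (DD a ha)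
    rw [inv_inv] at this
    rw [this, m2_tr]; simp [DD]
  obtain ⟨n', hn', ht', hm', hy'⟩ := common_line h3 hsq (H _ hm) (by
      rw [htm]
      intro h
      apply hsq a
      field_simp at h
      linear_combination h) (by
      rw [htm]
      intro h
      apply ha1
      field_simp at h
      have : (a * a - 1) * (a * a - 1) = 0 := by linear_combination h - a * a * h3
      have := mul_self_eq_zero.1 this
      linear_combination this)
  obtain ⟨e1, e2, e3, _⟩ := line_conj R n'
  rw [LStab_conj e1] at hm' hy'
  have e4 : R * (R⁻¹ * DD a ha * R) * R⁻¹ = DD a ha := by group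
  rw [e4] at hm'
  have e5 : R * y * R⁻¹ = UU (-s) * y1 * UU s := by
    have : UU s = (UU (-s))⁻¹ := by rw [UU_inv, neg_neg]
    rw [this, hR, hy1]; group
  rw [e5] at hy'
  refine DD_line h2 ha ?_ (e3 hn') (e2.trans ht') hm' hy' ?_ ?_ ?_
  · intro h
    have : (a * a - 1) * (a * a + 1) = 0 := by linear_combination h
    rcases mul_eq_zero.1 this with h | h
    · exact ha1 (by linear_combination h)
    · exact hsq a (by linear_combination h)
  · simp only [sl2_mul_val, m2_mul]; simp
    intro h; apply hs1; linear_combination h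
  · simp only [sl2_mul_val, m2_mul]; simp
    intro h; apply hs2; linear_combination h
  · simp only [sl2_mul_val, m2_mul]; simpa using h10

end lines

section torus
variable {F : Type*} [Field F]

theorem exists_alpha (hsq : ∀ r : F, r * r ≠ -1) (h2 : (2 : F) ≠ 0) {a : F} (ha : a ≠ 0)
    (ha1 : a * a ≠ 1) {d : F} (hd : d ≠ 0) :
    ∃ α β : F, α ≠ 0 ∧ β ≠ 0 ∧ α * α + β * β * d = 1 := by
  obtain ⟨t, ht0, ht1, ht2⟩ : ∃ t : F, t ≠ 0 ∧ 1 + t * t * d ≠ 0 ∧ 1 - t * t * d ≠ 0 := by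
    by_cases h : d * d = 1
    · refine ⟨a, ha, ?_⟩
      have : (d - 1) * (d + 1) = 0 := by linear_combination h
      have hp : 1 + a * a ≠ 0 := fun h => hsq a (by linear_combination h)
      have hm : 1 - a * a ≠ 0 := fun h => ha1 (by linear_combination -h)
      rcases mul_eq_zero.1 this with h | h
      · have : d = 1 := sub_eq_zero.1 h
        subst this
        simpa using ⟨hp, hm⟩
      · have : d = -1 := eq_neg_of_add_eq_zero_left h
        subst this
        refine ⟨?_, ?_⟩
        · intro h; apply hm; linear_combination h
        · intro h; apply hp; linear_combination h
    · refine ⟨1, one_ne_zero, ?_, ?_⟩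
      · intro h'; apply h; linear_combination (d - 1) * h'
      · intro h'; apply h; linear_combination (-1 - d) * h'
  refine ⟨(1 - t * t * d) / (1 + t * t * d), 2 * t / (1 + t * t * d), div_ne_zero ht2 ht1,
    div_ne_zero (mul_ne_zero h2 ht0) ht1, ?_⟩
  rw [div_mul_div_comm, div_mul_div_comm, div_mul_eq_mul_div, ← add_div,
    div_eq_one_iff_eq (mul_ne_zero ht1 ht1)]
  ring

theorem torus (h3 : (3 : F) = 0) (hsq : ∀ r : F, r * r ≠ -1) {a : F} (ha : a ≠ 0)
    (ha1 : a * a ≠ 1) {n : M2 F} (hn : n.trace = 0) (hd : n.det ≠ 0) (y : SL2 F)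
    (H : ∀ m ∈ LStab n, Solv m y) :
    y ∈ LStab n ∨ ∃ (n' : M2 F) (κ : F), n' ≠ 0 ∧ n'.trace = 0 ∧ n'.det = 0 ∧
      y ∈ LStab n' ∧ n' * n = κ • n' ∧ κ * κ = - n.det := by
  have h2 := two_ne_of_three h3
  obtain ⟨α, β, hα, hβ, hαβ⟩ := exists_alpha hsq h2 ha ha1 hd
  have hn11 : n 1 1 = - n 0 0 := by rw [m2_tr] at hn; linear_combination hn
  have hnn : n * n = (-n.det) • 1 := by
    rw [m2_ext_iff, m2_det]
    simp only [m2_mul]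
    simp [hn11]
    refine ⟨by ring, by ring, by ring, by ring⟩
  let m : SL2 F := ⟨α • 1 + β • n, by
    rw [m2_det] at hαβ ⊢
    simp [hn11]
    rw [hn11] at hαβ
    linear_combination hαβ⟩
  have hmv : m.1 = α • 1 + β • n := rfl
  have hmn : m ∈ LStab n := ⟨1, by rw [hmv]; simp [mul_add, add_mul]⟩
  have htm : m.1.trace = 2 * α := by rw [hmv, m2_tr]; simp [hn11]; ring
  obtain ⟨n', hn', ht', ⟨l, hl⟩, hy'⟩ := common_line h3 hsq (H m hmn)
    (by rw [htm]; exact mul_ne_zero h2 hα)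
    (by
      rw [htm]
      intro h
      have : β * β * n.det = 0 := by linear_combination hαβ - h + α * α * h3
      simp [hβ, hd] at this)
  have hn11' : n' 1 1 = - n' 0 0 := by rw [m2_tr] at ht'; linear_combination ht'
  obtain ⟨τ, hτ⟩ : ∃ τ : F, n * n' = τ • 1 - n' * n := by
    refine ⟨2 * n 0 0 * n' 0 0 + n 0 1 * n' 1 0 + n 1 0 * n' 0 1, ?_⟩
    rw [m2_ext_iff]
    simp only [Matrix.sub_apply, m2_mul]
    simp [hn11, hn11']
    refine ⟨by ring, by ring, by ring, by ring⟩
  have hA : ((1 - l) * α) • n' + (β * τ) • (1 : M2 F) = ((1 + l) * β) • (n' * n) := by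
    rw [hmv, add_mul, mul_add, smul_mul_assoc, smul_mul_assoc, mul_smul_comm, mul_smul_comm,
      one_mul, mul_one, hτ] at hl
    linear_combination (norm := module) hl
  have hAtr : τ * (1 - l) = 0 := by
    have h1 := congrArg Matrix.trace hA
    have h4 := congrArg Matrix.trace hτ
    rw [Matrix.trace_sub, Matrix.trace_mul_comm n n', Matrix.trace_smul] at h4
    rw [Matrix.trace_add, Matrix.trace_smul, Matrix.trace_smul, Matrix.trace_smul, ht'] at h1
    simp at h1 h4
    have : β * (τ * (1 - l)) = 0 := by
      have h5 : 2 * (β * (τ * (1 - l))) = 0 := by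
        linear_combination 2 * h1 + (1 + l) * β * h4
      simpa [h2] using h5
    simpa [hβ] using this
  rcases mul_eq_zero.1 hAtr with h | h
  · by_cases hl1 : l = -1
    · exfalso
      subst hl1
      rw [h] at hA
      simp at hA
      rcases hA with hA | hA
      · rcases hA with hA | hA
        · apply h2; linear_combination hA
        · exact hα hA
      · exact hn' hA
    · have hl1' : 1 + l ≠ 0 := fun h => hl1 (by linear_combination h)
      by_cases hll : l = 1
      · exfalso
        subst hll
        have hA2 : ((1 + 1) * β) • (n' * n) = 0 := by rw [← hA, h]; simp
        rcases smul_eq_zero.1 hA2 with hA | hA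
        · rcases mul_eq_zero.1 hA with hA | hA
          · apply h2; linear_combination hA
          · exact hβ hA
        · have : n' * n * n = 0 := by rw [hA]; simp
          rw [mul_assoc, hnn] at this
          simp [hd, hn'] at this
      right
      refine ⟨n', (1 - l) * α / ((1 + l) * β), hn', ht', ?_, hy', ?_⟩
      swap
      · have hk : n' * n = ((1 - l) * α / ((1 + l) * β)) • n' := by
          rw [h] at hA
          simp at hA
          rw [div_eq_inv_mul, mul_smul ((1 + l) * β)⁻¹, hA, smul_smul, inv_mul_cancel₀
            (mul_ne_zero hl1' hβ), one_smul]
        refine ⟨hk, ?_⟩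
        generalize (1 - l) * α / ((1 + l) * β) = κ at hk
        have h5 : n' * n * n = (κ * κ) • n' := by rw [hk, smul_mul_assoc, hk, smul_smul]
        rw [mul_assoc, hnn, mul_smul_comm, mul_one] at h5
        have : (κ * κ + n.det) • n' = 0 := by
          linear_combination (norm := module) -h5
        rcases smul_eq_zero.1 this with h | h
        · linear_combination h
        · exact absurd h hn'
      · have hk : n' * n = ((1 - l) * α / ((1 + l) * β)) • n' := by
          rw [h] at hA
          simp at hA
          rw [div_eq_inv_mul, mul_smul ((1 + l) * β)⁻¹, hA, smul_smul, inv_mul_cancel₀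
            (mul_ne_zero hl1' hβ), one_smul]
        -- n' n n' = κ n'² and = -κ n'²
        have hκ : (1 - l) * α / ((1 + l) * β) ≠ 0 := by
          refine div_ne_zero (mul_ne_zero ?_ hα) (mul_ne_zero hl1' hβ)
          intro h; apply hll; linear_combination -h
        generalize (1 - l) * α / ((1 + l) * β) = κ at hk hκ
        have h5 : n * n' = (-κ) • n' := by rw [hτ, h, hk]; simp
        have h6 : n' * n * n' = κ • (n' * n') := by rw [hk, smul_mul_assoc]
        rw [mul_assoc, h5, mul_smul_comm] at h6
        have h7 : (2 * κ) • (n' * n') = 0 := by linear_combination (norm := module) -h6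
        have h8 : n' * n' = 0 := by
          rcases smul_eq_zero.1 h7 with h | h
          · simp [h2, hκ] at h
          · exact h
        have h9 := congrArg Matrix.det h8
        rw [Matrix.det_mul] at h9
        simpa using h9
  · left
    have hl1 : l = 1 := by linear_combination -h
    subst hl1
    have h5 : n' * n = (τ / 2) • 1 := by
      have : (2 * β) • (n' * n) = (2 * β) • ((τ / 2) • (1 : M2 F)) := by
        have e : (2 * β) • ((τ / 2) • (1 : M2 F)) = (β * τ) • 1 := by
          rw [smul_smul]; congr 1; field_simp
        rw [e]
        linear_combination (norm := module) -hA
      exact smul_right_injective _ (mul_ne_zero h2 hβ) this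
    have h6 : n' * n * n = (τ / 2) • n := by rw [h5, smul_mul_assoc, one_mul]
    rw [mul_assoc, hnn, mul_smul_comm, mul_one] at h6
    have h7 : n' = ((-n.det)⁻¹ * (τ / 2)) • n := by
      rw [mul_smul, ← h6, smul_smul, inv_mul_cancel₀ (neg_ne_zero.2 hd), one_smul]
    rw [h7] at hy'
    rwa [LStab_smul] at hy'
    intro h8
    rw [h8] at h7
    exact hn' (by rw [h7]; simp)

/-- The split case. -/
theorem split_line (h2 : (2 : F) ≠ 0) {n n' : M2 F} {κ : F} (hn : n.trace = 0)
    (hn0 : n' ≠ 0) (ht' : n'.trace = 0) (hd' : n'.det = 0) (hk : n' * n = κ • n') (hκ : κ ≠ 0)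
    {x y : SL2 F}
    (hnil : ∀ n : M2 F, n ≠ 0 → n.trace = 0 → n.det = 0 → x ∈ LStab n → y ∈ LStab n)
    (hyn' : y ∈ LStab n') (hxn' : x ∈ LStab n') (hx : x ∈ LStab n) : y ∈ LStab n := by
  obtain ⟨P, c, hc, hP⟩ := exists_conj_E12 n' hn0 ht' hd'
  obtain ⟨e1, e2, -, -⟩ := line_conj P n
  have hPP : (P⁻¹).1 * P.1 = 1 := congrArg Subtype.val (inv_mul_cancel P)
  have hPP' : P.1 * (P⁻¹).1 = 1 := congrArg Subtype.val (mul_inv_cancel P)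
  rw [hn] at e2
  obtain ⟨n1, hn1⟩ : ∃ n1, n1 = P.1 * n * (P⁻¹).1 := ⟨_, rfl⟩
  rw [← hn1] at e1 e2
  have hE : E12 * n1 = κ • E12 := by
    have h1 : (c • E12) * n1 = κ • (c • E12) := by
      have h4 : c • E12 = P.1 * n' * (P⁻¹).1 := by rw [hP, mul_assoc, hPP', mul_one]
      rw [h4, hn1]
      calc P.1 * n' * (P⁻¹).1 * (P.1 * n * (P⁻¹).1)
          = P.1 * n' * ((P⁻¹).1 * P.1) * n * (P⁻¹).1 := by simp only [mul_assoc]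
        _ = P.1 * (n' * n) * (P⁻¹).1 := by rw [hPP]; simp only [mul_assoc, mul_one, one_mul]
        _ = _ := by rw [hk]; simp [mul_smul_comm, smul_mul_assoc]
    rw [smul_mul_assoc, smul_comm κ c] at h1
    exact smul_right_injective _ hc h1
  simp only [m2_ext_iff, m2_mul] at hE
  simp [E12] at hE
  have h00 : n1 0 0 = -κ := by rw [m2_tr, hE.2] at e2; linear_combination e2
  obtain ⟨R, hR⟩ : ∃ R : SL2 F, R = UU (-(n1 0 1) / (2 * κ)) * P := ⟨_, rfl⟩
  have hRn : R.1 * n = (κ • !![-1, 0; 0, 1]) * R.1 := by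
    rw [hR, sl2_mul_val, mul_assoc, e1, ← mul_assoc, ← mul_assoc]
    congr 1
    rw [m2_ext_iff]
    simp only [m2_mul]
    simp [hE, h00]
    field_simp
    ring
  have hRE : R.1 * n' = (c • E12) * R.1 := by
    rw [hR, sl2_mul_val, mul_assoc, hP, ← mul_assoc, ← mul_assoc]
    congr 1
    rw [m2_ext_iff]
    simp only [m2_mul]
    simp [E12]
  rw [LStab_conj hRn, LStab_smul hκ] at hx ⊢
  rw [LStab_conj hRE, LStab_smul hc, mem_LStab_E12] at hyn' hxn'
  -- the opposite nilpotent line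
  have hRR : (R⁻¹).1 * R.1 = 1 := congrArg Subtype.val (inv_mul_cancel R)
  have hRR' : R.1 * (R⁻¹).1 = 1 := congrArg Subtype.val (mul_inv_cancel R)
  obtain ⟨f1, f2, f3, f4⟩ := line_conj R⁻¹ (!![0, 0; 1, 0] : M2 F)
  rw [inv_inv] at f1 f2 f3 f4
  obtain ⟨k, hkk⟩ : ∃ k : M2 F, k = (R⁻¹).1 * !![0, 0; 1, 0] * R.1 := ⟨_, rfl⟩
  rw [← hkk] at f1 f2 f3 f4
  have hRk : R.1 * k = !![0, 0; 1, 0] * R.1 := by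
    rw [hkk, ← mul_assoc, ← mul_assoc, hRR', one_mul]
  have hyk := hnil k (f3 (by
      intro h; have := congrFun (congrFun h 1) 0; simp at this))
    (by rw [f2, m2_tr]; simp) (by rw [f4, m2_det]; simp)
  rw [LStab_conj hRk, LStab_conj hRk] at hyk
  generalize R * x * R⁻¹ = x1 at hx hxn' hyk
  generalize R * y * R⁻¹ = y1 at hyn' hyk ⊢
  have hx01 : x1.1 0 1 = 0 := by
    have hdx := sl2_det x1
    obtain ⟨l, hl⟩ := hx
    simp only [m2_ext_iff, m2_mul, Matrix.smul_apply] at hl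
    simp [hxn'] at hl hdx
    grind
  have hy1 : y1 ∈ LStab (!![0, 0; 1, 0] : M2 F) := by
    apply hyk
    refine ⟨x1.1 1 1 / x1.1 0 0, ?_⟩
    have hdx := sl2_det x1
    rw [hx01, hxn'] at hdx
    simp only [m2_ext_iff, m2_mul, Matrix.smul_apply]
    simp [hx01]
    grind
  have hy01 : y1.1 0 1 = 0 := by
    have hdy := sl2_det y1
    obtain ⟨l, hl⟩ := hy1
    simp only [m2_ext_iff, m2_mul, Matrix.smul_apply] at hl
    simp at hl
    exact hl.1
  refine ⟨1, ?_⟩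
  simp only [m2_ext_iff, m2_mul, Matrix.smul_apply]
  simp [hy01, hyn']

end torus

section final
variable {F : Type*} [Field F]

theorem mem_LStab_of_pm {g a : SL2 F} (h : g * a = a * g ∨ g * a = -(a * g)) : g ∈ LStab a.1 := by
  rcases h with h | h
  · exact ⟨1, by rw [one_smul]; exact congrArg Subtype.val h⟩
  · refine ⟨-1, ?_⟩
    rw [← sl2_mul_val, h, sl2_neg_val, sl2_mul_val]; simp

theorem pm_of_mem_LStab {g a : SL2 F} (h : g ∈ LStab a.1) :
    g * a = a * g ∨ g * a = -(a * g) := by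
  obtain ⟨l, hl⟩ := h
  have h1 := congrArg Matrix.det hl
  rw [Matrix.det_smul, Matrix.det_mul, Matrix.det_mul, g.2, a.2] at h1
  simp at h1
  have h2 : (l - 1) * (l + 1) = 0 := by linear_combination -h1
  rcases mul_eq_zero.1 h2 with h1 | h1
  · have h1 := sub_eq_zero.1 h1
    left; rw [sl2_ext_iff, sl2_mul_val, sl2_mul_val, hl, h1, one_smul]
  · have h1 := eq_neg_of_add_eq_zero_left h1
    right; rw [sl2_ext_iff, sl2_neg_val, sl2_mul_val, sl2_mul_val, hl, h1]; simp

theorem lines_frame {a b g : SL2 F} (ha : g ∈ LStab a.1) (hb : g ∈ LStab b.1) :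
    g ∈ FStab a b := by
  have h1 := pm_conj (pm_of_mem_LStab ha)
  have h2 := pm_conj (pm_of_mem_LStab hb)
  have h3 : PMEq (g * (a * b) * g⁻¹) (a * b) := by
    have e : g * (a * b) * g⁻¹ = (g * a * g⁻¹) * (g * b * g⁻¹) := by group
    rw [e]; exact h1.mul h2
  have key : ∀ x c : SL2 F, PMEq (g * c * g⁻¹) c → (PMEq x c ↔ PMEq (g * x * g⁻¹) c) := by
    intro x c hc
    constructor
    · intro h; exact (h.conj g).trans hc
    · intro h; exact (h.trans hc.symm).of_conj g
  refine Subgroup.mem_set_normalizer_iff.2 fun x => ?_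
  simp only [Fr, Set.mem_ofPred_eq]
  rw [key x a h1, key x b h2, key x (a * b) h3]

theorem Fr_comm {a b c : SL2 F} (hF : IsFrame a b) (hc : c ∈ Fr a b) :
    (c * a = a * c ∨ c * a = -(a * c)) ∧ (c * b = b * c ∨ c * b = -(b * c)) := by
  have hba := anti_symm hF.2.2
  have hab := hF.2.2
  have base : ∀ d, d ∈ Fr a b → ∀ e : SL2 F, PMEq d e → 
      ((e * a = a * e ∨ e * a = -(a * e)) ∧ (e * b = b * e ∨ e * b = -(b * e))) →
      (d * a = a * d ∨ d * a = -(a * d)) ∧ (d * b = b * d ∨ d * b = -(b * d)) := by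
    rintro d _ e (rfl | rfl) h
    · exact h
    · simpa only [neg_mul, mul_neg, neg_inj] using h
  rcases id hc with h | h | h
  · exact base c hc a h ⟨Or.inl rfl, Or.inr hab⟩
  · exact base c hc b h ⟨Or.inr hba, Or.inl rfl⟩
  · refine base c hc _ h ⟨Or.inr ?_, Or.inr ?_⟩
    · rw [mul_assoc, hba, mul_neg]
    · rw [← mul_assoc b a b, hba, neg_mul, neg_neg]

theorem Fr_pair (h2 : (2 : F) ≠ 0) {a b c d : SL2 F} (hF : IsFrame a b) (hc : c ∈ Fr a b)
    (hd : d ∈ Fr a b) : PMEq c d ∨ c * d = -(d * c) := by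
  have base : ∀ u v : SL2 F, PMEq c u → PMEq d v → u * v = -(v * u) → c * d = -(d * c) := by
    rintro u v (rfl | rfl) (rfl | rfl) h <;> simp [h]
  have hab := hF.2.2
  have hba := anti_symm hF.2.2
  have hr := (hF.rot h2).1
  have h1 := hr.2.2
  have h1' := anti_symm h1
  have h3 : a * (a * b) = -(a * b * a) := by
    rw [mul_assoc, hba, mul_neg, neg_neg]
  have h3' := anti_symm h3
  rcases hc with hc | hc | hc <;> rcases hd with hd | hd | hd
  · exact Or.inl (hc.trans hd.symm)
  · exact Or.inr (base _ _ hc hd hab)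
  · exact Or.inr (base _ _ hc hd h3)
  · exact Or.inr (base _ _ hc hd hba)
  · exact Or.inl (hc.trans hd.symm)
  · exact Or.inr (base _ _ hc hd h1)
  · exact Or.inr (base _ _ hc hd h3')
  · exact Or.inr (base _ _ hc hd h1')
  · exact Or.inl (hc.trans hd.symm)

theorem tr_zero_entry (hsq : ∀ r : F, r * r ≠ -1) {a : SL2 F} (ha : a.1.trace = 0) :
    a.1 1 0 ≠ 0 := by
  intro h
  have hd := sl2_det a
  rw [m2_tr] at ha
  rw [h] at hd
  apply hsq (a.1 0 0)
  linear_combination a.1 0 0 * ha - hd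

theorem unip_frame (h3 : (3 : F) = 0) (hsq : ∀ r : F, r * r ≠ -1) {P g a a' b' : SL2 F} {r : F}
    (hg : PMEq (P * g * P⁻¹) (UU r)) (hr : r ≠ 0) (ha : a.1.trace = 0) (hF : IsFrame a' b')
    (haF : a ∈ FStab a' b') (hgF : g ∈ FStab a' b') :
    r * r * ((P * a * P⁻¹).1 1 0 * (P * a * P⁻¹).1 1 0) = 1 := by
  have h2 := two_ne_of_three h3
  have ha' : a ∈ Fr a' b' := by
    rcases frame_tr h3 hsq hF haF with h | h
    · rw [ha] at h; simp at h
    · exact h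
  have hga := Fr_conj hgF ha'
  have hpair := Fr_pair h2 hF ha' hga
  -- transfer to coordinates
  have hat : (P * a * P⁻¹).1.trace = 0 := by rw [tr_conj, ha]
  obtain ⟨A, hA⟩ : ∃ A, A = P * a * P⁻¹ := ⟨_, rfl⟩
  have hconj : P * (g * a * g⁻¹) * P⁻¹ = UU r * A * UU (-r) := by
    have e : P * (g * a * g⁻¹) * P⁻¹ = (P * g * P⁻¹) * (P * a * P⁻¹) * (P * g * P⁻¹)⁻¹ := by group
    rw [e, ← hA, ← UU_inv]
    rcases hg with hg | hg <;> rw [hg] <;> simp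
  rw [← hA] at hat ⊢
  have hA10 := tr_zero_entry hsq hat
  have hd := sl2_det A
  have hA11 : A.1 1 1 = - A.1 0 0 := by rw [m2_tr] at hat; linear_combination hat
  rcases hpair with h | h
  · exfalso
    have h4 := h.conj P
    rw [hconj, ← hA] at h4
    rcases h4 with h4 | h4
    · rw [sl2_ext_iff, sl2_mul_val, sl2_mul_val, m2_ext_iff] at h4
      simp only [m2_mul] at h4
      simp at h4
      have := h4.1
      simp [hr, hA10] at this
    · rw [sl2_ext_iff, sl2_neg_val, sl2_mul_val, sl2_mul_val, m2_ext_iff] at h4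
      simp only [Matrix.neg_apply, m2_mul] at h4
      simp at h4
      have := h4.2.2.1
      have h5 : 2 * A.1 1 0 = 0 := by linear_combination this
      simp [h2, hA10] at h5
  · have h4 := anti_mul_tr h2 h
    rw [← tr_conj P] at h4
    have e : P * (a * (g * a * g⁻¹)) * P⁻¹ = (P * a * P⁻¹) * (P * (g * a * g⁻¹) * P⁻¹) := by group
    rw [e, hconj, ← hA, m2_tr, sl2_mul_val, sl2_mul_val, sl2_mul_val] at h4
    simp only [m2_mul] at h4
    simp [hA11] at h4
    rw [hA11] at hd
    linear_combination -h4 - 2 * hd - h3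

theorem neg_mem_FStab {a b g : SL2 F} (h : g ∈ FStab a b) : -g ∈ FStab a b := by
  refine Subgroup.mem_set_normalizer_iff.2 fun x => ?_
  have := Subgroup.mem_set_normalizer_iff.1 h x
  simpa using this

theorem isPM_mem_LStab {g : SL2 F} (h : IsPM g) (n : M2 F) : g ∈ LStab n := by
  refine ⟨1, ?_⟩
  rcases h with rfl | rfl
  · simp
  · rw [sl2_neg_val]; simp

/-- Frame case. -/
theorem frame_case (h3 : (3 : F) = 0) (hsq : ∀ r : F, r * r ≠ -1) {a b x y : SL2 F}
    (hF : IsFrame a b) (hx : x ∈ FStab a b)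
    (hns : ∀ c : SL2 F, c.1.trace = 0 → x ∈ LStab c.1 → y ∈ LStab c.1)
    (hnil : ∀ n : M2 F, n ≠ 0 → n.trace = 0 → n.det = 0 → (x ∈ LStab n ↔ y ∈ LStab n))
    (hs : Solv a y) : y ∈ FStab a b := by
  have h2 := two_ne_of_three h3
  have done : x ∈ LStab a.1 → x ∈ LStab b.1 → y ∈ FStab a b := fun ha hb =>
    lines_frame (hns a hF.1 ha) (hns b hF.2.1 hb)
  rcases frame_tr h3 hsq hF hx with ht | hxF
  swap
  · have := Fr_comm hF hxF
    exact done (mem_LStab_of_pm this.1) (mem_LStab_of_pm this.2)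
  by_cases hpm : IsPM x
  · exact done (isPM_mem_LStab hpm _) (isPM_mem_LStab hpm _)
  -- x0 = ± x is unipotent
  obtain ⟨x0, hx0, hx0t⟩ : ∃ x0, PMEq x x0 ∧ x0.1.trace = 2 := by
    have : (x.1.trace - 1) * (x.1.trace + 1) = 0 := by linear_combination ht
    rcases mul_eq_zero.1 this with h | h
    · refine ⟨-x, Or.inr (by simp), ?_⟩
      rw [tr_neg]; linear_combination -h - h3
    · exact ⟨x, Or.inl rfl, by linear_combination h - h3⟩
  have hx0n : x0.1 - 1 ≠ 0 := by
    intro h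
    have : x0 = 1 := (sl2_ext_iff _ _).2 (sub_eq_zero.1 h)
    rw [this] at hx0
    exact hpm hx0
  have hd0 := sl2_det x0
  obtain ⟨P, c, hc, hP⟩ := exists_conj_E12 (x0.1 - 1) hx0n
    (by rw [Matrix.trace_sub, hx0t]; simp)
    (by rw [m2_tr] at hx0t; rw [m2_det]; simp; linear_combination hd0 - hx0t)
  have hz' : P * x0 * P⁻¹ = UU c := by
    rw [mul_inv_eq_iff_eq_mul, sl2_ext_iff, sl2_mul_val, sl2_mul_val]
    have e : (UU c).1 = 1 + c • E12 := by
      rw [m2_ext_iff]; simp [E12]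
    rw [e, add_mul, ← hP]; simp [mul_sub]
  have hxU : PMEq (P * x * P⁻¹) (UU c) := by rw [← hz']; exact hx0.conj P
  -- nilpotent lines in coordinates
  have hnil' : ∀ n : M2 F, n ≠ 0 → n.trace = 0 → n.det = 0 →
      (P * x * P⁻¹ ∈ LStab n ↔ P * y * P⁻¹ ∈ LStab n) := by
    intro n hn ht hd
    obtain ⟨f1, f2, f3, f4⟩ := line_conj P⁻¹ n
    rw [inv_inv] at f1 f2 f3 f4
    have hRR' : P.1 * (P⁻¹).1 = 1 := congrArg Subtype.val (mul_inv_cancel P)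
    have hRk : P.1 * ((P⁻¹).1 * n * P.1) = n * P.1 := by
      rw [← mul_assoc, ← mul_assoc, hRR', one_mul]
    have := hnil _ (f3 hn) (f2.trans ht) (f4.trans hd)
    rwa [LStab_conj hRk, LStab_conj hRk] at this
  obtain ⟨y1, hy1⟩ : ∃ y1, y1 = P * y * P⁻¹ := ⟨_, rfl⟩
  obtain ⟨x1, hx1⟩ : ∃ x1, x1 = P * x * P⁻¹ := ⟨_, rfl⟩
  rw [← hx1, ← hy1] at hnil'
  rw [← hx1] at hxU
  have hUmem : ∀ (g h : SL2 F) (n : M2 F), PMEq g h → g ∈ LStab n → h ∈ LStab n := by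
    rintro g h n (rfl | rfl) hh
    · exact hh
    · have := mul_mem (isPM_mem_LStab (Or.inr rfl) n) hh
      simpa using this
  have hy10 : y1.1 1 0 = 0 := by
    have := (hnil' E12 (by
      intro h; have := congrFun (congrFun h 0) 1; simp [E12] at this)
      (by rw [m2_tr]; simp [E12]) (by rw [m2_det]; simp [E12])).1
      (hUmem _ _ _ hxU.symm (mem_LStab_E12.2 (by simp)))
    exact mem_LStab_E12.1 this
  have hdy := sl2_det y1
  rw [hy10] at hdy
  have hyd : y1.1 0 0 = y1.1 1 1 := by
    by_contra hne
    have hne' : y1.1 1 1 - y1.1 0 0 ≠ 0 := fun h => hne (sub_eq_zero.1 h).symm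
    obtain ⟨s, hs⟩ : ∃ s, y1.1 0 0 * s + y1.1 0 1 = y1.1 1 1 * s :=
      ⟨y1.1 0 1 / (y1.1 1 1 - y1.1 0 0), by field_simp; ring⟩
    have hn0 : (!![s, -(s * s); 1, -s] : M2 F) ≠ 0 := by
      intro h; have := congrFun (congrFun h 1) 0; simp at this
    have hnt : (!![s, -(s * s); 1, -s] : M2 F).trace = 0 := by rw [m2_tr]; simp
    have h5 := (hnil' !![s, -(s * s); 1, -s] hn0 hnt (by rw [m2_det]; simp)).2 (by
      refine ⟨y1.1 1 1 * y1.1 1 1, ?_⟩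
      simp only [m2_ext_iff, m2_mul, Matrix.smul_apply]
      simp [hy10]
      grind)
    have := (UU_line h2 hc hnt (hUmem _ _ _ hxU h5)).2.1
    simp at this
  have hyU : PMEq y1 (UU (y1.1 0 0 * y1.1 0 1)) := by
    have : (y1.1 0 0 - 1) * (y1.1 0 0 + 1) = 0 := by rw [← hyd] at hdy; linear_combination hdy
    rcases mul_eq_zero.1 this with h | h
    · left
      rw [sl2_ext_iff, m2_ext_iff]
      simp [hy10, ← hyd, sub_eq_zero.1 h]
    · right
      rw [sl2_ext_iff, m2_ext_iff, sl2_neg_val]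
      simp [hy10, ← hyd, eq_neg_of_add_eq_zero_left h]
  generalize y1.1 0 0 * y1.1 0 1 = r at hyU
  by_cases hr : r = 0
  · have hy : IsPM y := by
      rw [hr, (UU_eq_one (0 : F)).2 rfl, hy1] at hyU
      exact (isPM_conj (g := P)).1 hyU
    exact lines_frame (isPM_mem_LStab hy _) (isPM_mem_LStab hy _)
  -- main part
  have hat : (P * a * P⁻¹).1.trace = 0 := by rw [tr_conj, hF.1]
  have hA10 := tr_zero_entry hsq hat
  have hc1 := unip_frame h3 hsq (hx1 ▸ hxU) hc hF.1 hF
    (lines_frame (mem_LStab_of_pm (Or.inl rfl)) (mem_LStab_of_pm (Or.inr hF.2.2))) hx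
  have hr1 : r * r * ((P * a * P⁻¹).1 1 0 * (P * a * P⁻¹).1 1 0) = 1 := by
    rcases structure_thm h2 _ hs with ⟨n, hn, ht, hle⟩ | ⟨a', b', hF', hle⟩
    · exfalso
      have ham : a ∈ LStab n := hle (Subgroup.subset_closure (by simp))
      have hym : y ∈ LStab n := hle (Subgroup.subset_closure (by simp))
      obtain ⟨e1, e2, e3, -⟩ := line_conj P n
      rw [LStab_conj e1] at ham hym
      obtain ⟨n1, hn1⟩ : ∃ n1, n1 = P.1 * n * (P⁻¹).1 := ⟨_, rfl⟩
      rw [← hn1] at ham hym e2 e3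
      rw [← hy1] at hym
      obtain ⟨u1, u2, u3⟩ := UU_line h2 hr (e2.trans ht) (hUmem _ _ _ hyU hym)
      have e4 : n1 = (n1 0 1) • E12 := by
        rw [m2_ext_iff]; simp [E12, u1, u2, u3]
      have e5 : n1 0 1 ≠ 0 := by
        intro h; rw [h] at e4; exact e3 hn (by rw [e4]; simp)
      rw [e4, LStab_smul e5, mem_LStab_E12] at ham
      exact hA10 ham
    · exact unip_frame h3 hsq (hy1 ▸ hyU) hr hF.1 hF' (hle (Subgroup.subset_closure (by simp)))
        (hle (Subgroup.subset_closure (by simp)))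
  have hrc : (r - c) * (r + c) = 0 := by
    have : (r * r - c * c) * ((P * a * P⁻¹).1 1 0 * (P * a * P⁻¹).1 1 0) = 0 := by
      linear_combination hr1 - hc1
    have := (mul_eq_zero.1 this).resolve_right (mul_ne_zero hA10 hA10)
    linear_combination this
  have hmemPM : ∀ g h : SL2 F, PMEq g h → h ∈ FStab a b → g ∈ FStab a b := by
    rintro g h (rfl | rfl) hh
    · exact hh
    · exact neg_mem_FStab hh
  rcases mul_eq_zero.1 hrc with h | h
  · rw [sub_eq_zero.1 h] at hyU
    have := hyU.trans hxU.symm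
    rw [hx1, hy1] at this
    exact hmemPM _ _ (this.of_conj P) hx
  · rw [eq_neg_of_add_eq_zero_left h, ← UU_inv] at hyU
    have h6 : PMEq (UU c)⁻¹ x1⁻¹ := by
      rcases hxU.symm with h | h
      · exact Or.inl (by rw [h])
      · right; rw [h, inv_neg]
    have := hyU.trans h6
    rw [hx1, hy1] at this
    have e : (P * x * P⁻¹)⁻¹ = P * x⁻¹ * P⁻¹ := by group
    rw [e] at this
    exact hmemPM _ _ (this.of_conj P) (inv_mem hx)

theorem main_SL2 [Finite F] (h3 : (3 : F) = 0) (hsq : ∀ r : F, r * r ≠ -1)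
    (hprop : ∀ H : Subgroup (SL2 F), H ≠ ⊤ → Group.IsSolvable H) (hcard : 4 ≤ Nat.card F)
    {c : F} (hc0 : c ≠ 0) (hc1 : c * c ≠ 1) {x y : SL2 F} (hxy : ∀ z, Solv x z ↔ Solv y z)
    (M : Subgroup (SL2 F)) (hM : IsCoatom M) (hx : x ∈ M) : y ∈ M := by
  have h2 := two_ne_of_three h3
  have symm : ∀ g h : SL2 F, Solv g h → Solv h g := by
    intro g h hh
    unfold Solv at *
    rwa [Set.pair_comm]
  have hLs : ∀ n : M2 F, n ≠ 0 → n.trace = 0 → Group.IsSolvable (LStab n) := fun n hn ht =>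
    hprop _ (LStab_ne_top h2 hn ht)
  have hnil1 : ∀ u v : SL2 F, (∀ z, Solv u z ↔ Solv v z) → ∀ n : M2 F, n ≠ 0 → n.trace = 0 →
      n.det = 0 → u ∈ LStab n → v ∈ LStab n := by
    intro u v huv n hn ht hd hu
    refine nil_line h3 hsq hcard hc0 hc1 hn ht hd v fun m hm => symm _ _ ?_
    rw [← huv]
    exact Solv_of_mem _ (hLs n hn ht) hu hm
  have hnil : ∀ n : M2 F, n ≠ 0 → n.trace = 0 → n.det = 0 → (x ∈ LStab n ↔ y ∈ LStab n) :=
    fun n hn ht hd => ⟨hnil1 x y hxy n hn ht hd, hnil1 y x (fun z => (hxy z).symm) n hn ht hd⟩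
  have hline : ∀ n : M2 F, n ≠ 0 → n.trace = 0 → x ∈ LStab n → y ∈ LStab n := by
    intro n hn ht hxn
    by_cases hd : n.det = 0
    · exact (hnil n hn ht hd).1 hxn
    rcases torus h3 hsq hc0 hc1 ht hd y (fun m hm => symm _ _ (by
      rw [← hxy]
      exact Solv_of_mem _ (hLs n hn ht) hxn hm)) with h | ⟨n', κ, hn', ht', hd', hy', hk, hκ⟩
    · exact h
    · refine split_line h2 ht hn' ht' hd' hk ?_ (fun n hn ht hd => (hnil n hn ht hd).1) hy'
        ((hnil n' hn' ht' hd').2 hy') hxn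
      rintro rfl
      apply hd
      linear_combination hκ
  have hmax : ∀ K : Subgroup (SL2 F), M ≤ K → K ≠ ⊤ → K = M := by
    intro K hMK hK
    by_contra hne
    exact hK (hM.2 K (lt_of_le_of_ne hMK (fun h => hne h.symm)))
  rcases structure_thm h2 M (hprop M hM.1) with ⟨n, hn, ht, hle⟩ | ⟨a, b, hF, hle⟩
  · rw [← hmax _ hle (LStab_ne_top h2 hn ht)] at hx ⊢
    exact hline n hn ht hx
  · have hFt := FStab_ne_top h3 hsq hc0 hc1 hF
    rw [← hmax _ hle hFt] at hx ⊢
    refine frame_case h3 hsq hF hx ?_ hnil ?_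
    · intro d hd
      refine hline d.1 ?_ hd
      intro h
      have := d.2
      rw [h] at this
      simp at this
    · apply symm
      rw [← hxy]
      exact Solv_of_mem _ (hprop _ hFt) hx
        (lines_frame (mem_LStab_of_pm (Or.inl rfl)) (mem_LStab_of_pm (Or.inr hF.2.2)))

end final

section final

theorem gl2_card_det {F : Type*} [Field F] [Finite F] (d : ℕ) (hd : d ∣ Nat.card (SL2 F)) :
    d * (Nat.card F - 1) ∣ (Nat.card F ^ 2 - 1) * (Nat.card F ^ 2 - Nat.card F) := by
  classical
  have : Fintype F := Fintype.ofFinite F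
  have hcard := Matrix.card_GL_field (𝔽 := F) 2
  rw [Fin.prod_univ_two] at hcard
  simp only [Fin.val_zero, Fin.val_one, pow_zero, pow_one, ← Nat.card_eq_fintype_card] at hcard
  have hs : Function.Surjective
      (Matrix.GeneralLinearGroup.det : GL (Fin 2) F →* Fˣ) := by
    intro u
    refine ⟨Matrix.GeneralLinearGroup.mkOfDetNeZero !![(u : F), 0; 0, 1] (by simp), ?_⟩
    ext
    simp [Matrix.GeneralLinearGroup.mkOfDetNeZero, Matrix.det_fin_two]
  have hidx : (Matrix.GeneralLinearGroup.det : GL (Fin 2) F →* Fˣ).ker.index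
      = Nat.card F - 1 := by
    rw [Subgroup.index_ker, MonoidHom.range_eq_top.2 hs, Subgroup.card_top, Nat.card_units]
  have hle : (Matrix.SpecialLinearGroup.toGL : SL2 F →* GL (Fin 2) F).range
      ≤ (Matrix.GeneralLinearGroup.det : GL (Fin 2) F →* Fˣ).ker := by
    rintro _ ⟨g, rfl⟩
    rw [MonoidHom.mem_ker]
    ext
    simp
  have h1 : Nat.card (SL2 F) = Nat.card
      (Matrix.SpecialLinearGroup.toGL : SL2 F →* GL (Fin 2) F).range :=
    Nat.card_congr (MonoidHom.ofInjective Matrix.SpecialLinearGroup.toGL_injective).toEquiv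
  rw [← hcard, ← Subgroup.card_mul_index
    (Matrix.GeneralLinearGroup.det : GL (Fin 2) F →* Fˣ).ker, hidx]
  exact Nat.mul_dvd_mul_right ((h1 ▸ hd).trans (Subgroup.card_dvd_of_le hle)) _

theorem three_pow_mod {p : ℕ} (hodd : Odd p) : 3 ^ p % 16 = 3 ∨ 3 ^ p % 16 = 11 := by
  obtain ⟨k, rfl⟩ := hodd
  induction k with
  | zero => simp
  | succ k ih =>
    have : 3 ^ (2 * (k + 1) + 1) = 9 * 3 ^ (2 * k + 1) := by ring
    rw [this]
    generalize 3 ^ (2 * k + 1) = a at ih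
    omega

theorem not_sixteen_dvd {q : ℕ} (hq : q % 16 = 3 ∨ q % 16 = 11) :
    ¬ 16 * (q - 1) ∣ (q ^ 2 - 1) * (q ^ 2 - q) := by
  intro h
  obtain ⟨m, rfl⟩ : ∃ m, q = m + 1 := ⟨q - 1, by omega⟩
  have e : ((m + 1) ^ 2 - 1) * ((m + 1) ^ 2 - (m + 1)) = (m * (m + 2) * (m + 1)) * m := by
    have e1 : (m + 1) ^ 2 = m * (m + 2) + 1 := by ring
    have e2 : (m + 1) ^ 2 = m * (m + 1) + (m + 1) := by ring
    have e3 : (m + 1) ^ 2 - 1 = m * (m + 2) := by omega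
    have e4 : (m + 1) ^ 2 - (m + 1) = m * (m + 1) := by omega
    rw [e3, e4]; ring
  rw [e, Nat.add_sub_cancel] at h
  have h2 := Nat.dvd_of_mul_dvd_mul_right (by omega) h
  have h3 := Nat.mod_eq_zero_of_dvd h2
  rcases hq with hq | hq
  · have : m % 16 = 2 := by omega
    simp [Nat.mul_mod, Nat.add_mod, this] at h3
  · have : m % 16 = 10 := by omega
    simp [Nat.mul_mod, Nat.add_mod, this] at h3

theorem prime_degree_sub {F : Type*} [Field F] [Algebra (ZMod 3) F]
    (hp : (Module.finrank (ZMod 3) F).Prime)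
    (L : AddSubgroup F) (c l : F) (hc : c ∈ L) (hc0 : c ≠ 0) (hl0 : l ≠ 0) (hl1 : l ≠ 1)
    (hl2 : l ≠ -1) (hL : ∀ t ∈ L, l * t ∈ L) : L = ⊤ := by
  have := Subalgebra.isSimpleOrder_of_finrank_prime (ZMod 3) F hp
  have hbot : ∀ r : ZMod 3, algebraMap (ZMod 3) F r = 0 ∨ algebraMap (ZMod 3) F r = 1 ∨
      algebraMap (ZMod 3) F r = -1 := by
    intro r
    have : r = 0 ∨ r = 1 ∨ r = -1 := by revert r; decide
    rcases this with rfl | rfl | rfl <;> simp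
  have htop : Algebra.adjoin (ZMod 3) {l} = ⊤ := by
    rcases eq_bot_or_eq_top (Algebra.adjoin (ZMod 3) {l}) with h | h
    · exfalso
      have hm : l ∈ Algebra.adjoin (ZMod 3) {l} := Algebra.subset_adjoin rfl
      rw [h, Algebra.mem_bot] at hm
      obtain ⟨r, rfl⟩ := hm
      rcases hbot r with h | h | h
      · exact hl0 h
      · exact hl1 h
      · exact hl2 h
    · exact h
  have key : ∀ s ∈ Algebra.adjoin (ZMod 3) {l}, ∀ t ∈ L, s * t ∈ L := by
    intro s hs
    induction hs using Algebra.adjoin_induction with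
    | mem x hx => rw [Set.mem_singleton_iff] at hx; subst hx; exact hL
    | algebraMap r =>
      intro t ht
      rcases hbot r with h | h | h <;> rw [h]
      · simp
      · simpa
      · simpa using ht
    | add x y _ _ hx hy => intro t ht; rw [add_mul]; exact L.add_mem (hx t ht) (hy t ht)
    | mul x y _ _ hx hy => intro t ht; rw [mul_assoc]; exact hx _ (hy t ht)
  rw [eq_top_iff]
  intro t _
  have := key (t * c⁻¹) (htop ▸ Algebra.mem_top) c hc
  rwa [inv_mul_cancel_right₀ hc0] at this

theorem map_mk_closure {G : Type*} [Group G] (N : Subgroup G) [N.Normal] (x z : G) :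
    (Subgroup.closure {x, z}).map (QuotientGroup.mk' N) =
      Subgroup.closure {QuotientGroup.mk' N x, QuotientGroup.mk' N z} := by
  rw [MonoidHom.map_closure, Set.image_pair]

theorem solv_quotient_iff {G : Type*} [Group G] (x z : G) :
    Group.IsSolvable (Subgroup.closure {QuotientGroup.mk' (Subgroup.center G) x,
      QuotientGroup.mk' (Subgroup.center G) z}) ↔
      Group.IsSolvable (Subgroup.closure {x, z}) := by
  rw [← map_mk_closure]
  obtain ⟨H, hH⟩ : ∃ H, H = Subgroup.closure {x, z} := ⟨_, rfl⟩
  rw [← hH]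
  constructor
  · intro h
    let f := (QuotientGroup.mk' (Subgroup.center G)).comp H.subtype
    have hr : f.range = H.map (QuotientGroup.mk' (Subgroup.center G)) := by
      rw [MonoidHom.range_comp, Subgroup.range_subtype]
    rw [← hr] at h
    refine solvable_of_central_ker f ?_
    intro g hg
    rw [MonoidHom.mem_ker] at hg
    have hg' : (g : G) ∈ Subgroup.center G := (QuotientGroup.eq_one_iff _).1 hg
    rw [Subgroup.mem_center_iff] at hg' ⊢
    intro k
    exact Subtype.ext (hg' k)
  · intro h
    exact Group.isSolvable_of_surjective
      ((QuotientGroup.mk' (Subgroup.center G)).subgroupMap_surjective H)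

theorem coatom_comap {G H : Type*} [Group G] [Group H] (f : G →* H)
    (hf : Function.Surjective f) {M : Subgroup H} (hM : IsCoatom M) : IsCoatom (M.comap f) := by
  constructor
  · intro h
    apply hM.1
    rw [← Subgroup.map_comap_eq_self_of_surjective hf M, h, ← MonoidHom.range_eq_map,
      MonoidHom.range_eq_top.2 hf]
  · intro K hK
    have hker : f.ker ≤ K := (Subgroup.ker_le_comap f M).trans hK.le
    have e : (K.map f).comap f = K := by
      rw [Subgroup.comap_map_eq, sup_eq_left.2 hker]
    have : K.map f = ⊤ := by
      apply hM.2
      refine lt_of_le_of_ne ?_ ?_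
      · rw [← Subgroup.map_comap_eq_self_of_surjective hf M]
        exact Subgroup.map_mono hK.le
      · intro h
        rw [h, e] at hK
        exact lt_irrefl _ hK
    rw [← e, this, Subgroup.comap_top]

theorem main_galois (p : ℕ) (hp : p.Prime) (hodd : Odd p) {x y : SL2 (GaloisField 3 p)}
    (hxy : ∀ z, Solv x z ↔ Solv y z) (M : Subgroup (SL2 (GaloisField 3 p))) (hM : IsCoatom M)
    (hx : x ∈ M) : y ∈ M := by
  have hcardF : Nat.card (GaloisField 3 p) = 3 ^ p := GaloisField.card 3 p hp.ne_zero
  have hfin : Finite (GaloisField 3 p) := Nat.finite_of_card_ne_zero (by rw [hcardF]; positivity)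
  have : Fintype (GaloisField 3 p) := Fintype.ofFinite _
  have hmod := three_pow_mod hodd
  have h4 : 4 ≤ Nat.card (GaloisField 3 p) := by
    rw [hcardF]
    calc 4 ≤ 3 ^ 2 := by norm_num
      _ ≤ 3 ^ p := Nat.pow_le_pow_right (by norm_num) hp.two_le
  have hsq : ∀ r : GaloisField 3 p, r * r ≠ -1 := by
    intro r hr
    have : IsSquare (-1 : GaloisField 3 p) := ⟨r, hr.symm⟩
    rw [FiniteField.isSquare_neg_one_iff, ← Nat.card_eq_fintype_card, hcardF] at this
    omega
  have hsub := prime_degree_sub (F := GaloisField 3 p)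
    (by rw [GaloisField.finrank 3 hp.ne_zero]; exact hp)
  have h16 : ¬ 16 ∣ Nat.card (SL2 (GaloisField 3 p)) := by
    intro h
    have := gl2_card_det 16 h
    rw [hcardF] at this
    exact not_sixteen_dvd hmod this
  have hc : ∃ c : GaloisField 3 p, c ≠ 0 ∧ c * c ≠ 1 := by
    classical
    by_contra! hcon
    have hle : (Finset.univ : Finset (GaloisField 3 p)) ⊆ {0, 1, -1} := by
      intro c _
      by_cases h0 : c = 0
      · simp [h0]
      · rcases mul_self_eq_one_iff.1 (hcon c h0) with h | h <;> simp [h]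
    have := (Finset.card_le_card hle).trans Finset.card_le_three
    rw [Finset.card_univ, ← Nat.card_eq_fintype_card] at this
    omega
  obtain ⟨c, hc0, hc1⟩ := hc
  exact main_SL2 (by exact_mod_cast CharP.cast_eq_zero (GaloisField 3 p) 3) hsq
    (fun H hH => solvable_of_proper hsq hsub h16 H hH) h4 hc0 hc1 hxy M hM hx

theorem main_PSL (p : ℕ) (hp : p.Prime) (hodd : Odd p)
    (x y : PS (GaloisField 3 p))
    (h : ∀ z, Group.IsSolvable (Subgroup.closure {x, z}) ↔
      Group.IsSolvable (Subgroup.closure {y, z}))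
    (M : Subgroup (PS (GaloisField 3 p))) (hM : IsCoatom M) (hx : x ∈ M) : y ∈ M := by
  have hs := QuotientGroup.mk'_surjective (Subgroup.center (SL2 (GaloisField 3 p)))
  obtain ⟨a, rfl⟩ := hs x
  obtain ⟨b, rfl⟩ := hs y
  have key := main_galois p hp hodd (x := a) (y := b) (fun z => by
    have := h (QuotientGroup.mk' _ z)
    rw [solv_quotient_iff, solv_quotient_iff] at this
    exact this) _ (coatom_comap _ hs hM) hx
  exact key

end final


/-- Let `p` be an odd prime and `G = PSL(2, 2^p)`. If `x, y ∈ G` have equal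
solvabilizers, then `x` and `y` lie in exactly the same maximal subgroups of `G`. -/
theorem mem_same_maximal_subgroups_PSL_char_three
    (p : ℕ) (hp : p.Prime) (hodd : Odd p)
    (x y : PSL 2 (GaloisField 3 p))
    (h : solvabilizer x = solvabilizer y) :
    ∀ M : Subgroup (PSL 2 (GaloisField 3 p)), IsCoatom M → (x ∈ M ↔ y ∈ M) := by
  intro M hM
  have h' : ∀ z, Group.IsSolvable (Subgroup.closure {x, z}) ↔
      Group.IsSolvable (Subgroup.closure {y, z}) := fun z => by
    have := Set.ext_iff.1 h z
    exact this
  exact ⟨main_PSL p hp hodd x y h' M hM, main_PSL p hp hodd y x (fun z => (h' z).symm) M hM⟩
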